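/- Let Γ be a set of topological lines in ℝ² such that γ \ γ' is a portion of γ for all distinct γ, γ' ∈ Γ; define J(γ,γ') := cl(γ △ γ') and the relation σ ∈ (γ, γ')_Γ iff J(γ, σ) ⊂ cl(Int J(γ, γ')). Then the relation is transitive in the following sense: for all distinct γ, σ, σ', σ'' ∈ Γ, if γ ∈ (σ, σ')_Γ and γ ∉ (σ, σ'')_Γ, then γ ∈ (σ', σ'')_Γ. -/

import Mathlib

abbrev Plane := ℝ × ℝ

/-- A topological line: a subset of the plane homeomorphic to `ℝ`. -/
def IsTopLine (γ : Set Plane) : Prop := Nonempty (ℝ ≃ₜ γ)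

/-- A portion of a topological line `γ` : a subset whose preimage under any
parametrizing homeomorphism `ℝ ≃ₜ γ` is a bounded open interval. -/
def IsPortion (γ π : Set Plane) : Prop :=
  π ⊆ γ ∧ ∀ Φ : ℝ ≃ₜ γ, ∃ a b : ℝ, {t : ℝ | (Φ t : Plane) ∈ π} = Set.Ioo a b

/-- A Jordan curve: a subset of the plane homeomorphic to the circle. -/
def IsJordanCurve (J : Set Plane) : Prop := Nonempty (Circle ≃ₜ J)

/-- Interior region of a Jordan curve. -/
def intRegion (J : Set Plane) : Set Plane :=
  {z | z ∉ J ∧ Bornology.IsBounded (connectedComponentIn Jᶜ z)}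

/-- Exterior region of a Jordan curve. -/
def extRegion (J : Set Plane) : Set Plane :=
  {z | z ∉ J ∧ ¬ Bornology.IsBounded (connectedComponentIn Jᶜ z)}

/-- The Jordan curve associated with two topological lines. -/
noncomputable def lineJ (γ γ' : Set Plane) : Set Plane := closure (symmDiff γ γ')

/-- The betweenness relation: `σ` lies between `γ` and `γ'`. -/
def Between (γ γ' σ : Set Plane) : Prop :=
  lineJ γ σ ⊆ closure (intRegion (lineJ γ γ'))

open Set Topology

/-- `f` has a continuous logarithm on `X`. -/
def HasLogOn (f : ℂ → ℂ) (X : Set ℂ) : Prop :=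
  ∃ L : ℂ → ℂ, ContinuousOn L X ∧ ∀ x ∈ X, Complex.exp (L x) = f x

/-- Every nonvanishing continuous function on `X` has a continuous logarithm on `X`. -/
def LogAcyclic (X : Set ℂ) : Prop :=
  ∀ f : ℂ → ℂ, ContinuousOn f X → (∀ x ∈ X, f x ≠ 0) → HasLogOn f X

lemma HasLogOn.congr {f g : ℂ → ℂ} {X : Set ℂ} (h : HasLogOn f X) (hfg : EqOn f g X) :
    HasLogOn g X := by
  obtain ⟨L, hL, hLe⟩ := h
  exact ⟨L, hL, fun x hx => (hLe x hx).trans (hfg hx)⟩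

lemma HasLogOn.mul {f g : ℂ → ℂ} {X : Set ℂ} (hf : HasLogOn f X) (hg : HasLogOn g X) :
    HasLogOn (fun x => f x * g x) X := by
  obtain ⟨L, hL, hLe⟩ := hf
  obtain ⟨M, hM, hMe⟩ := hg
  exact ⟨fun x => L x + M x, hL.add hM, fun x hx => by
    rw [Complex.exp_add, hLe x hx, hMe x hx]⟩

lemma HasLogOn.inv {f : ℂ → ℂ} {X : Set ℂ} (hf : HasLogOn f X) :
    HasLogOn (fun x => (f x)⁻¹) X := by
  obtain ⟨L, hL, hLe⟩ := hf
  exact ⟨fun x => - L x, hL.neg, fun x hx => by rw [Complex.exp_neg, hLe x hx]⟩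

lemma HasLogOn.div {f g : ℂ → ℂ} {X : Set ℂ} (hf : HasLogOn f X) (hg : HasLogOn g X) :
    HasLogOn (fun x => f x / g x) X := by
  simpa only [div_eq_mul_inv] using hf.mul hg.inv

lemma HasLogOn.of_mem_slitPlane {f : ℂ → ℂ} {X : Set ℂ} (hf : ContinuousOn f X)
    (h : ∀ x ∈ X, f x ∈ Complex.slitPlane) : HasLogOn f X :=
  ⟨fun x => Complex.log (f x), hf.clog h, fun x hx =>
    Complex.exp_log (Complex.slitPlane_ne_zero (h x hx))⟩

lemma hasLogOn_const {c : ℂ} (hc : c ≠ 0) (X : Set ℂ) : HasLogOn (fun _ => c) X :=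
  ⟨fun _ => Complex.log c, continuousOn_const, fun _ _ => Complex.exp_log hc⟩

lemma one_sub_mem_slitPlane {w : ℂ} (hw : ‖w‖ < 1) : 1 - w ∈ Complex.slitPlane := by
  simpa [sub_eq_add_neg] using Complex.mem_slitPlane_of_norm_lt_one (z := -w) (by simpa using hw)

/-- Two logarithms of the same function on a preconnected set differ by a constant. -/
lemma sub_eq_sub_of_exp_eq {α : Type*} [TopologicalSpace α] {A : Set α} (hA : IsPreconnected A)
    {L M : α → ℂ} (hL : ContinuousOn L A) (hM : ContinuousOn M A)
    (h : ∀ x ∈ A, Complex.exp (L x) = Complex.exp (M x)) {x y : α} (hx : x ∈ A) (hy : y ∈ A) :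
    L y - L x = M y - M x := by
  have key := Complex.isCoveringMap_exp.eqOn_of_comp_eqOn hA hL
    (hM.add (continuousOn_const (c := L x - M x))) (fun w hw => by
      have h1 : Complex.exp (L x - M x) = 1 := by
        rw [Complex.exp_sub, h x hx, div_self (Complex.exp_ne_zero _)]
      simp [Complex.exp_add, h1, h w hw]) hx (by simp)
  have hy' : L y = M y + (L x - M x) := key hy
  rw [hy']; ring

lemma continuous_hasLogOn {α : Type*} [TopologicalSpace α] [LocallyPathConnectedSpace α]
    [SimplyConnectedSpace α] {f : α → ℂ} (hf : Continuous f) (h0 : ∀ x, f x ≠ 0) :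
    ∃ L : α → ℂ, Continuous L ∧ ∀ x, Complex.exp (L x) = f x := by
  obtain ⟨x₀⟩ : Nonempty α := inferInstance
  obtain ⟨L, ⟨-, hL⟩, -⟩ := Complex.isCoveringMapOn_exp.existsUnique_continuousMap_lifts
    ⟨f, hf⟩ (Complex.exp_log (h0 x₀)) h0
  exact ⟨L, L.continuous, fun x => congrFun hL x⟩

/-- The `m`-th power of the identity has no logarithm on a circle, unless `m = 0`. -/
lemma eq_zero_of_hasLogOn_sphere {a : ℂ} {r : ℝ} (hr : 0 < r) {m : ℤ}
    (h : HasLogOn (fun z => (z - a) ^ m) (Metric.sphere a r)) : m = 0 := by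
  obtain ⟨L, hL, hLe⟩ := h
  have hmem : ∀ t : ℝ, circleMap a r t ∈ Metric.sphere a r :=
    fun t => circleMap_mem_sphere a hr.le t
  have key := sub_eq_sub_of_exp_eq (isPreconnected_univ (α := ℝ))
    (L := fun t => L (circleMap a r t))
    (M := fun t : ℝ => (m : ℂ) * (Complex.log r + t * Complex.I))
    (hL.comp (continuous_circleMap a r).continuousOn fun t _ => hmem t)
    (by fun_prop) (fun t _ => by
      rw [hLe _ (hmem t), Complex.exp_int_mul, Complex.exp_add,
        Complex.exp_log (by exact_mod_cast hr.ne')]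
      simp [circleMap]) (mem_univ 0) (mem_univ (2 * Real.pi))
  have h2 : circleMap a r (2 * Real.pi) = circleMap a r 0 := by simp [circleMap]
  simp only [h2, sub_self] at key
  have : (m : ℂ) * (2 * Real.pi * Complex.I) = 0 := by
    rw [key]; push_cast; ring
  simpa [Complex.two_pi_I_ne_zero] using this

/-- Borsuk's obstruction: if `U` is a bounded open set whose frontier lies in `X` and `a ∈ U`,
then `(z - a) ^ m * h z`, with `h` nonvanishing on the closure of `U`, has no logarithm on `X`,
unless `m = 0`. -/
lemma eq_zero_of_hasLogOn_frontier {X U : Set ℂ} (hX : IsClosed X) (hU : IsOpen U)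
    (hUb : Bornology.IsBounded U) (hUX : closure U ⊆ U ∪ X) {a : ℂ} (ha : a ∈ U)
    {m : ℤ} {h : ℂ → ℂ} (hh : ContinuousOn h (closure U)) (hh0 : ∀ z ∈ closure U, h z ≠ 0)
    (hlog : HasLogOn (fun z => (z - a) ^ m * h z) X) : m = 0 := by
  classical
  obtain ⟨L, hL, hLe⟩ := hlog
  obtain ⟨M, hM⟩ := ContinuousMap.exists_restrict_eq hX ⟨X.domRestrict L, hL.domRestrict⟩
  have hML : ∀ z ∈ X, M z = L z := fun z hz => by
    exact DFunLike.congr_fun hM ⟨z, hz⟩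
  have hane : ∀ z, z ∉ U → z - a ≠ 0 := fun z hz h0 => hz (by rwa [sub_eq_zero.1 h0])
  let g : ℂ → ℂ := fun z => if z ∈ U then Complex.exp (M z) / h z else (z - a) ^ m
  have hg : Continuous g := by
    refine continuous_if (p := fun z => z ∈ U) ?_ ?_ ?_
    · intro z hz
      have hz' : z ∈ frontier U := hz
      have hzU : z ∉ U := by rw [hU.frontier_eq] at hz'; exact hz'.2
      have hzc : z ∈ closure U := frontier_subset_closure hz'
      have hzX : z ∈ X := (hUX hzc).resolve_left hzU
      rw [hML z hzX, hLe z hzX]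
      exact mul_div_cancel_right₀ _ (hh0 z hzc)
    · exact ContinuousOn.div (by fun_prop) hh hh0
    · have : closure {z | z ∉ U} = Uᶜ := hU.isClosed_compl.closure_eq
      rw [this]
      exact ContinuousOn.zpow₀ (by fun_prop) m fun z hz => Or.inl (hane z hz)
  have hg0 : ∀ z, g z ≠ 0 := by
    intro z
    by_cases hz : z ∈ U
    · simp only [g, if_pos hz]
      exact div_ne_zero (Complex.exp_ne_zero _) (hh0 z (subset_closure hz))
    · simp only [g, if_neg hz]
      exact zpow_ne_zero _ (hane z hz)
  obtain ⟨G, hG, hGe⟩ := continuous_hasLogOn hg hg0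
  obtain ⟨r, hr, hUr⟩ := hUb.subset_ball_lt 0 a
  refine eq_zero_of_hasLogOn_sphere (a := a) hr ⟨G, hG.continuousOn, fun z hz => ?_⟩
  have hzU : z ∉ U := fun hzU => by
    have h1 := hUr hzU
    rw [Metric.mem_ball] at h1; rw [Metric.mem_sphere] at hz; linarith
  rw [hGe z]; simp only [g, if_neg hzU]

/-- Logarithms glue along a preconnected intersection, once they agree at one point of it. -/
lemma HasLogOn.union_of_agree {f : ℂ → ℂ} {X Y : Set ℂ} (hX : IsClosed X) (hY : IsClosed Y)
    {L M : ℂ → ℂ} (hL : ContinuousOn L X) (hLe : ∀ x ∈ X, Complex.exp (L x) = f x)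
    (hM : ContinuousOn M Y) (hMe : ∀ x ∈ Y, Complex.exp (M x) = f x)
    (h : ∀ x ∈ X ∩ Y, L x = M x) : HasLogOn f (X ∪ Y) := by
  classical
  have hY' : EqOn (X.piecewise L M) M Y := fun x hx => by
    by_cases hxX : x ∈ X
    · rw [piecewise_eq_of_mem _ _ _ hxX]; exact h x ⟨hxX, hx⟩
    · rw [piecewise_eq_of_notMem _ _ _ hxX]
  have hX' : EqOn (X.piecewise L M) L X := piecewise_eqOn X L M
  refine ⟨X.piecewise L M, (hL.congr hX').union_of_isClosed (hM.congr hY') hX hY, ?_⟩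
  rintro x (hx | hx)
  · rw [hX' hx, hLe x hx]
  · rw [hY' hx, hMe x hx]

lemma LogAcyclic.union {X Y : Set ℂ} (hXa : LogAcyclic X) (hYa : LogAcyclic Y)
    (hX : IsClosed X) (hY : IsClosed Y) {p : ℂ} (h : X ∩ Y = {p}) :
    LogAcyclic (X ∪ Y) := by
  intro f hf hf0
  obtain ⟨L, hL, hLe⟩ := hXa f (hf.mono subset_union_left) fun x hx => hf0 x (Or.inl hx)
  obtain ⟨M, hM, hMe⟩ := hYa f (hf.mono subset_union_right) fun x hx => hf0 x (Or.inr hx)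
  have hp : p ∈ X ∩ Y := h ▸ mem_singleton p
  have h1 : Complex.exp (L p - M p) = 1 := by
    rw [Complex.exp_sub, hLe p hp.1, hMe p hp.2, div_self (hf0 p (Or.inl hp.1))]
  refine HasLogOn.union_of_agree hX hY (M := fun x => M x + (L p - M p)) hL hLe
    (hM.add continuousOn_const) (fun x hx => by rw [Complex.exp_add, h1, mul_one, hMe x hx]) ?_
  rw [h]; rintro x rfl; ring

/-- An arc is log-acyclic. -/
lemma logAcyclic_image_Icc {c : ℝ → ℂ} (hc : IsEmbedding c) {a b : ℝ} (hab : a ≤ b) :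
    LogAcyclic (c '' Icc a b) := by
  intro f hf hf0
  have hci : Continuous c := hc.continuous
  obtain ⟨L, hL, hLe⟩ := continuous_hasLogOn (α := ℝ)
    (f := fun t => f (c (projIcc a b hab t)))
    (hf.comp_continuous (by fun_prop) fun t => mem_image_of_mem c (projIcc a b hab t).2)
    (fun t => hf0 _ (mem_image_of_mem c (projIcc a b hab t).2))
  have hinv : Function.LeftInverse (Function.invFun c) c := Function.leftInverse_invFun hc.injective
  refine ⟨fun z => L (Function.invFun c z), hL.comp_continuousOn ?_, ?_⟩
  · rw [hc.continuousOn_iff]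
    refine continuousOn_id.congr ?_
    rintro _ ⟨t, -, rfl⟩
    simp [hinv t]
  · rintro _ ⟨t, ht, rfl⟩
    simp only [hinv t, hLe, projIcc_of_mem hab ht]

/-- The union of the bounded components of the complement of `J`. -/
def innerRegion (J : Set ℂ) : Set ℂ :=
  {z | z ∉ J ∧ Bornology.IsBounded (connectedComponentIn Jᶜ z)}

/-- The union of the unbounded components of the complement of `J`. -/
def outerRegion (J : Set ℂ) : Set ℂ :=
  {z | z ∉ J ∧ ¬ Bornology.IsBounded (connectedComponentIn Jᶜ z)}

lemma isOpen_innerRegion {J : Set ℂ} (hJ : IsClosed J) : IsOpen (innerRegion J) := by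
  refine isOpen_iff_forall_mem_open.2 fun z hz => ⟨connectedComponentIn Jᶜ z, fun y hy => ?_,
    hJ.isOpen_compl.connectedComponentIn, mem_connectedComponentIn hz.1⟩
  exact ⟨connectedComponentIn_subset _ _ hy, (connectedComponentIn_eq hy) ▸ hz.2⟩

lemma isOpen_outerRegion {J : Set ℂ} (hJ : IsClosed J) : IsOpen (outerRegion J) := by
  refine isOpen_iff_forall_mem_open.2 fun z hz => ⟨connectedComponentIn Jᶜ z, fun y hy => ?_,
    hJ.isOpen_compl.connectedComponentIn, mem_connectedComponentIn hz.1⟩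
  exact ⟨connectedComponentIn_subset _ _ hy, (connectedComponentIn_eq hy) ▸ hz.2⟩

lemma mem_innerRegion_or_mem_outerRegion {J : Set ℂ} {z : ℂ} (hz : z ∉ J) :
    z ∈ innerRegion J ∨ z ∈ outerRegion J := by
  by_cases h : Bornology.IsBounded (connectedComponentIn Jᶜ z)
  · exact Or.inl ⟨hz, h⟩
  · exact Or.inr ⟨hz, h⟩

/-- Points far from a bounded set are in its outer region. -/
lemma mem_outerRegion_of_lt_norm {J : Set ℂ} {R : ℝ} (hJ : J ⊆ Metric.closedBall 0 R) {z : ℂ}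
    (hR : 0 ≤ R) (hz : R < ‖z‖) : z ∈ outerRegion J := by
  have hout : ∀ y : ℂ, R < ‖y‖ → y ∉ J := fun y hy hyJ => by
    have := hJ hyJ; rw [mem_closedBall_zero_iff] at this; linarith
  have hz0 : 0 < ‖z‖ := hR.trans_lt hz
  have hray : (fun t : ℝ => (t : ℂ) * z) '' Ici 1 ⊆ connectedComponentIn Jᶜ z := by
    refine IsPreconnected.subset_connectedComponentIn ?_ ⟨1, by simp⟩ ?_
    · exact isPreconnected_Ici.image _ (by fun_prop)
    · rintro _ ⟨t, ht, rfl⟩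
      refine hout _ ?_
      have ht1 : (1 : ℝ) ≤ t := ht
      simp only [norm_mul, Complex.norm_real, Real.norm_eq_abs,
        abs_of_pos (zero_lt_one.trans_le ht1)]
      nlinarith
  refine ⟨hout z hz, fun hb => ?_⟩
  obtain ⟨K, hK⟩ := (hb.subset hray).exists_norm_le
  have h1 := hK _ ⟨max 1 ((K + 1) / ‖z‖), mem_Ici.2 (le_max_left _ _), rfl⟩
  have h2 : (0 : ℝ) < max 1 ((K + 1) / ‖z‖) := lt_max_of_lt_left one_pos
  simp only [norm_mul, Complex.norm_real, Real.norm_eq_abs, abs_of_pos h2] at h1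
  have h3 : (K + 1) / ‖z‖ * ‖z‖ = K + 1 := div_mul_cancel₀ _ hz0.ne'
  have h4 := mul_le_mul_of_nonneg_right (le_max_right 1 ((K + 1) / ‖z‖)) hz0.le
  linarith

lemma isBounded_innerRegion {J : Set ℂ} (hJ : Bornology.IsBounded J) :
    Bornology.IsBounded (innerRegion J) := by
  obtain ⟨R, hR, hJR⟩ := hJ.subset_closedBall_lt 0 0
  refine Metric.isBounded_closedBall.subset (t := Metric.closedBall (0 : ℂ) R) fun z hz => ?_
  rw [mem_closedBall_zero_iff]
  by_contra! h
  exact (mem_outerRegion_of_lt_norm hJR hR.le h).2 hz.2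

lemma closure_innerRegion_subset {J : Set ℂ} (hJ : IsClosed J) :
    closure (innerRegion J) ⊆ innerRegion J ∪ J := by
  intro z hz
  by_contra! h
  simp only [mem_union, not_or] at h
  have hout := (mem_innerRegion_or_mem_outerRegion h.2).resolve_left h.1
  obtain ⟨y, hy, hy'⟩ := mem_closure_iff.1 hz _ (isOpen_outerRegion hJ) hout
  exact hy.2 hy'.2

/-- If `‖z - y‖` is smaller than the distance from `z` to `X`, then
`(w - y) / (w - z)` has a logarithm on `X`. -/
lemma one_sub_div_mem_slitPlane {X : Set ℂ} {z y w : ℂ} (hw : w ∈ X)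
    (h : ‖y - z‖ < Metric.infDist z X) : 1 - (y - z) / (w - z) ∈ Complex.slitPlane := by
  refine one_sub_mem_slitPlane ?_
  have h1 : Metric.infDist z X ≤ ‖w - z‖ := by
    rw [← dist_eq_norm, dist_comm]; exact Metric.infDist_le_dist_of_mem hw
  have h2 : 0 < ‖w - z‖ := (norm_nonneg _).trans_lt (h.trans_le h1)
  rw [norm_div, div_lt_one h2]
  exact h.trans_le h1

lemma sub_ne_zero_of_mem_of_notMem {X : Set ℂ} {w z : ℂ} (hw : w ∈ X) (hz : z ∉ X) :
    w - z ≠ 0 := sub_ne_zero.2 fun h => hz (h ▸ hw)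

lemma hasLogOn_div_of_mem_connectedComponentIn {X : Set ℂ} (hX : IsClosed X)
    {x z y : ℂ} (hz : z ∈ connectedComponentIn Xᶜ x) (hy : y ∈ connectedComponentIn Xᶜ x) :
    HasLogOn (fun w => (w - y) / (w - z)) X := by
  have hsub := connectedComponentIn_subset Xᶜ x
  rcases X.eq_empty_or_nonempty with rfl | hne
  · exact ⟨fun _ => 0, continuousOn_empty _, by simp⟩
  refine (isPreconnected_connectedComponentIn (x := x) (F := Xᶜ)).induction₂
    (fun z y => z ∈ Xᶜ → y ∈ Xᶜ → HasLogOn (fun w => (w - y) / (w - z)) X) ?_ ?_ ?_ hz hy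
    (hsub hz) (hsub hy)
  · intro z hz
    have hpos : 0 < Metric.infDist z X := (hX.notMem_iff_infDist_pos hne).1 (hsub hz)
    filter_upwards [mem_nhdsWithin_of_mem_nhds (Metric.ball_mem_nhds z hpos)] with y hy _ _
    have hy' : ‖y - z‖ < Metric.infDist z X := by rwa [← dist_eq_norm]
    have hne0 : ∀ w ∈ X, w - z ≠ 0 := fun w hw => sub_ne_zero_of_mem_of_notMem hw (hsub hz)
    refine HasLogOn.congr (f := fun w => 1 - (y - z) / (w - z))
      (HasLogOn.of_mem_slitPlane ?_ fun w hw => one_sub_div_mem_slitPlane hw hy') ?_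
    · exact continuousOn_const.sub (continuousOn_const.div (by fun_prop) hne0)
    · intro w hw
      have := hne0 w hw
      simp only
      field_simp
      ring
  · intro a b c _ hb _ hab hbc haX hcX
    refine ((hab haX (hsub hb)).mul (hbc (hsub hb) hcX)).congr fun w hw => ?_
    have h1 := sub_ne_zero_of_mem_of_notMem hw (hsub hb)
    have h2 := sub_ne_zero_of_mem_of_notMem hw haX
    simp only
    field_simp
  · intro a b _ _ hab hbX haX
    exact (hab haX hbX).inv.congr fun w _ => by simp only [inv_div]

lemma hasLogOn_sub_of_mem_outerRegion {X : Set ℂ} (hX : IsCompact X) {z : ℂ}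
    (hz : z ∈ outerRegion X) : HasLogOn (fun w => w - z) X := by
  obtain ⟨R, hR, hXR⟩ := hX.isBounded.subset_closedBall_lt 0 0
  obtain ⟨y, hy, hyR⟩ : ∃ y ∈ connectedComponentIn Xᶜ z, R < ‖y‖ := by
    by_contra! h
    exact hz.2 (Metric.isBounded_closedBall.subset (t := Metric.closedBall (0 : ℂ) R)
      fun y hy => by rw [mem_closedBall_zero_iff]; exact h y hy)
  have hy0 : y ≠ 0 := norm_pos_iff.1 (hR.trans hyR)
  have hlog : HasLogOn (fun w => w - y) X := by
    refine ((hasLogOn_const (neg_ne_zero.2 hy0) X).mul (HasLogOn.of_mem_slitPlane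
      (f := fun w => 1 - w / y) (by fun_prop) fun w hw => one_sub_mem_slitPlane ?_)).congr ?_
    · have := hXR hw
      rw [mem_closedBall_zero_iff] at this
      rw [norm_div, div_lt_one (hR.trans hyR)]
      linarith
    · intro w _
      simp only
      field_simp
      ring
  refine (hlog.mul (hasLogOn_div_of_mem_connectedComponentIn hX.isClosed hy
    (mem_connectedComponentIn hz.1))).congr fun w hw => ?_
  have := sub_ne_zero_of_mem_of_notMem hw (connectedComponentIn_subset _ _ hy)
  simp only
  field_simp

open Classical in
/-- The variation from `p` to `q` of a continuous logarithm of `w ↦ w - z` on `A`. -/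
noncomputable def logVar (A : Set ℂ) (p q z : ℂ) : ℂ :=
  if h : HasLogOn (fun w => w - z) A then h.choose q - h.choose p else 0

lemma logVar_eq {A : Set ℂ} (hA : IsPreconnected A) {p q z : ℂ} (hp : p ∈ A) (hq : q ∈ A)
    {L : ℂ → ℂ} (hL : ContinuousOn L A) (hLe : ∀ w ∈ A, Complex.exp (L w) = w - z) :
    logVar A p q z = L q - L p := by
  have h : HasLogOn (fun w => w - z) A := ⟨L, hL, hLe⟩
  rw [logVar, dif_pos h]
  exact sub_eq_sub_of_exp_eq hA h.choose_spec.1 hL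
    (fun x hx => by rw [h.choose_spec.2 x hx, hLe x hx]) hp hq

lemma LogAcyclic.hasLogOn_sub {A : Set ℂ} (hA : LogAcyclic A) {z : ℂ} (hz : z ∉ A) :
    HasLogOn (fun w => w - z) A :=
  hA _ (by fun_prop) fun _ hw => sub_ne_zero_of_mem_of_notMem hw hz

/-- Additivity of the variation under concatenation. -/
lemma logVar_union {A B : Set ℂ} (hA : IsPreconnected A) (hB : IsPreconnected B)
    {p r q z : ℂ} (hp : p ∈ A) (hrA : r ∈ A) (hrB : r ∈ B) (hq : q ∈ B)
    (h : HasLogOn (fun w => w - z) (A ∪ B)) :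
    logVar (A ∪ B) p q z = logVar A p r z + logVar B r q z := by
  obtain ⟨L, hL, hLe⟩ := h
  rw [logVar_eq (hA.union r hrA hrB hB) (Or.inl hp) (Or.inr hq) hL hLe,
    logVar_eq hA hp hrA (hL.mono subset_union_left) fun w hw => hLe w (Or.inl hw),
    logVar_eq hB hrB hq (hL.mono subset_union_right) fun w hw => hLe w (Or.inr hw)]
  ring

lemma exp_logVar {A : Set ℂ} (hA : IsPreconnected A) (hAl : LogAcyclic A) {p q z : ℂ}
    (hp : p ∈ A) (hq : q ∈ A) (hz : z ∉ A) :
    Complex.exp (logVar A p q z) = (q - z) / (p - z) := by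
  obtain ⟨L, hL, hLe⟩ := hAl.hasLogOn_sub hz
  rw [logVar_eq hA hp hq hL hLe, Complex.exp_sub, hLe q hq, hLe p hp]

lemma continuousAt_logVar {A : Set ℂ} (hA : IsPreconnected A) (hAl : LogAcyclic A)
    (hAc : IsClosed A) {p q z : ℂ} (hp : p ∈ A) (hq : q ∈ A) (hz : z ∉ A) :
    ContinuousAt (logVar A p q) z := by
  obtain ⟨L, hL, hLe⟩ := hAl.hasLogOn_sub hz
  have hpos : 0 < Metric.infDist z A := (hAc.notMem_iff_infDist_pos ⟨p, hp⟩).1 hz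
  have hne : ∀ w ∈ A, w - z ≠ 0 := fun w hw => sub_ne_zero_of_mem_of_notMem hw hz
  have hev : logVar A p q =ᶠ[𝓝 z] fun y => (L q + Complex.log (1 - (y - z) / (q - z))) -
      (L p + Complex.log (1 - (y - z) / (p - z))) := by
    filter_upwards [Metric.ball_mem_nhds z hpos] with y hy
    have hy' : ‖y - z‖ < Metric.infDist z A := by rwa [← dist_eq_norm]
    refine logVar_eq hA hp hq (L := fun w => L w + Complex.log (1 - (y - z) / (w - z)))
      (hL.add (ContinuousOn.clog ?_ fun w hw => one_sub_div_mem_slitPlane hw hy')) ?_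
    · exact continuousOn_const.sub (continuousOn_const.div (by fun_prop) hne)
    · intro w hw
      rw [Complex.exp_add, hLe w hw, Complex.exp_log
        (Complex.slitPlane_ne_zero (one_sub_div_mem_slitPlane hw hy'))]
      have := hne w hw
      field_simp
      ring
  refine ContinuousAt.congr ?_ hev.symm
  have hlog : ∀ w, ContinuousAt (fun y => Complex.log (1 - (y - z) / (w - z))) z := fun w =>
    ContinuousAt.clog (by fun_prop) (by simp)
  exact (continuousAt_const.add (hlog q)).sub (continuousAt_const.add (hlog p))

/-- Two arcs with common endpoints `p ≠ q` which are otherwise disjoint: their union is a Jordan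
curve. -/
structure JordanPair (A B : Set ℂ) (p q : ℂ) : Prop where
  compact_left : IsCompact A
  compact_right : IsCompact B
  preconnected_left : IsPreconnected A
  preconnected_right : IsPreconnected B
  acyclic_left : LogAcyclic A
  acyclic_right : LogAcyclic B
  inter_eq : A ∩ B = {p, q}
  ne : p ≠ q
  exists_acyclic : ∀ x ∈ A ∪ B, ∀ V, IsOpen V → x ∈ V →
    ∃ D, IsClosed D ∧ LogAcyclic D ∧ (A ∪ B) \ V ⊆ D ∧ D ⊆ A ∪ B

namespace JordanPair

variable {A B : Set ℂ} {p q : ℂ}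

lemma left_mem (h : JordanPair A B p q) : p ∈ A ∩ B := by rw [h.inter_eq]; simp

lemma right_mem (h : JordanPair A B p q) : q ∈ A ∩ B := by rw [h.inter_eq]; simp

lemma isCompact (h : JordanPair A B p q) : IsCompact (A ∪ B) :=
  h.compact_left.union h.compact_right

lemma logVar_left (h : JordanPair A B p q) {z : ℂ} {L : ℂ → ℂ} (hL : ContinuousOn L A)
    (hLe : ∀ w ∈ A, Complex.exp (L w) = w - z) : logVar A p q z = L q - L p :=
  logVar_eq h.preconnected_left h.left_mem.1 h.right_mem.1 hL hLe

lemma logVar_right (h : JordanPair A B p q) {z : ℂ} {L : ℂ → ℂ} (hL : ContinuousOn L B)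
    (hLe : ∀ w ∈ B, Complex.exp (L w) = w - z) : logVar B p q z = L q - L p :=
  logVar_eq h.preconnected_right h.left_mem.2 h.right_mem.2 hL hLe

lemma hasLogOn_union (h : JordanPair A B p q) {f L M : ℂ → ℂ}
    (hL : ContinuousOn L A) (hLe : ∀ w ∈ A, Complex.exp (L w) = f w)
    (hM : ContinuousOn M B) (hMe : ∀ w ∈ B, Complex.exp (M w) = f w)
    (heq : L q - L p = M q - M p) : HasLogOn f (A ∪ B) := by
  have hp := h.left_mem
  have h1 : Complex.exp (L p - M p) = 1 := by
    rw [Complex.exp_sub, hLe p hp.1, ← hMe p hp.2, div_self (Complex.exp_ne_zero _)]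
  refine HasLogOn.union_of_agree h.compact_left.isClosed h.compact_right.isClosed
    (M := fun x => M x + (L p - M p)) hL hLe (hM.add continuousOn_const)
    (fun x hx => by rw [Complex.exp_add, h1, mul_one, hMe x hx]) ?_
  rw [h.inter_eq]
  rintro x (rfl | rfl)
  · ring
  · linear_combination heq

lemma logVar_eq_of_mem_outerRegion (h : JordanPair A B p q) {z : ℂ}
    (hz : z ∈ outerRegion (A ∪ B)) : logVar A p q z = logVar B p q z := by
  obtain ⟨L, hL, hLe⟩ := hasLogOn_sub_of_mem_outerRegion h.isCompact hz
  rw [h.logVar_left (hL.mono subset_union_left) fun w hw => hLe w (Or.inl hw),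
    h.logVar_right (hL.mono subset_union_right) fun w hw => hLe w (Or.inr hw)]

lemma logVar_ne_of_mem_innerRegion (h : JordanPair A B p q) {z : ℂ}
    (hz : z ∈ innerRegion (A ∪ B)) : logVar A p q z ≠ logVar B p q z := by
  intro heq
  have hzA : z ∉ A := fun hA => hz.1 (Or.inl hA)
  have hzB : z ∉ B := fun hB => hz.1 (Or.inr hB)
  obtain ⟨L, hL, hLe⟩ := h.acyclic_left.hasLogOn_sub hzA
  obtain ⟨M, hM, hMe⟩ := h.acyclic_right.hasLogOn_sub hzB
  rw [h.logVar_left hL hLe, h.logVar_right hM hMe] at heq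
  have hlog := h.hasLogOn_union hL hLe hM hMe heq
  have := eq_zero_of_hasLogOn_frontier (m := 1) (h := fun _ => 1) h.isCompact.isClosed
    (isOpen_innerRegion h.isCompact.isClosed) (isBounded_innerRegion h.isCompact.isBounded)
    (closure_innerRegion_subset h.isCompact.isClosed) hz continuousOn_const (by simp)
    (hlog.congr fun w _ => by simp)
  exact one_ne_zero this

lemma exists_int (h : JordanPair A B p q) {z : ℂ} (hz : z ∉ A ∪ B) :
    ∃ n : ℤ, logVar A p q z = logVar B p q z + n * (2 * Real.pi * Complex.I) := by
  have hzA : z ∉ A := fun hA => hz (Or.inl hA)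
  have hzB : z ∉ B := fun hB => hz (Or.inr hB)
  refine Complex.exp_eq_exp_iff_exists_int.1 ?_
  rw [exp_logVar h.preconnected_left h.acyclic_left h.left_mem.1 h.right_mem.1 hzA,
    exp_logVar h.preconnected_right h.acyclic_right h.left_mem.2 h.right_mem.2 hzB]

/-- The winding number is constant on the inner region. -/
lemma logVar_sub_eq (h : JordanPair A B p q) {z y : ℂ}
    (hz : z ∈ innerRegion (A ∪ B)) (hy : y ∈ innerRegion (A ∪ B)) :
    logVar A p q z - logVar B p q z = logVar A p q y - logVar B p q y := by
  obtain ⟨L, hL, hLe⟩ := h.acyclic_left.hasLogOn_sub fun hA => hz.1 (Or.inl hA)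
  obtain ⟨M, hM, hMe⟩ := h.acyclic_right.hasLogOn_sub fun hB => hz.1 (Or.inr hB)
  obtain ⟨L', hL', hLe'⟩ := h.acyclic_left.hasLogOn_sub fun hA => hy.1 (Or.inl hA)
  obtain ⟨M', hM', hMe'⟩ := h.acyclic_right.hasLogOn_sub fun hB => hy.1 (Or.inr hB)
  by_cases hc : y ∈ connectedComponentIn (A ∪ B)ᶜ z
  · obtain ⟨N, hN, hNe⟩ := hasLogOn_div_of_mem_connectedComponentIn h.isCompact.isClosed
      (mem_connectedComponentIn hz.1) hc
    have hexp : ∀ {K : ℂ → ℂ} {w : ℂ}, w ∈ A ∪ B → Complex.exp (K w) = w - z →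
        Complex.exp (K w + N w) = w - y := fun {K w} hw hK => by
      have := sub_ne_zero_of_mem_of_notMem hw hz.1
      rw [Complex.exp_add, hK, hNe w hw]
      field_simp
    rw [h.logVar_left hL hLe, h.logVar_right hM hMe,
      h.logVar_left (hL.add (hN.mono subset_union_left)) fun w hw => hexp (Or.inl hw) (hLe w hw),
      h.logVar_right (hM.add (hN.mono subset_union_right)) fun w hw =>
        hexp (Or.inr hw) (hMe w hw)]
    simp only [Pi.add_apply]
    ring
  · exfalso
    obtain ⟨n, hn⟩ := h.exists_int hz.1
    obtain ⟨m, hm⟩ := h.exists_int hy.1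
    have hm0 : m ≠ 0 := by
      rintro rfl
      exact h.logVar_ne_of_mem_innerRegion hy (by simpa using hm)
    rw [h.logVar_left hL hLe, h.logVar_right hM hMe] at hn
    rw [h.logVar_left hL' hLe', h.logVar_right hM' hMe'] at hm
    have hlog : HasLogOn (fun w => (w - z) ^ m * (w - y) ^ (-n)) (A ∪ B) := by
      refine h.hasLogOn_union (L := fun w => m * L w + (-n : ℤ) * L' w)
        (M := fun w => m * M w + (-n : ℤ) * M' w) (by fun_prop) (fun w hw => ?_)
        (by fun_prop) (fun w hw => ?_) ?_
      · rw [Complex.exp_add, Complex.exp_int_mul, Complex.exp_int_mul, hLe w hw, hLe' w hw]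
      · rw [Complex.exp_add, Complex.exp_int_mul, Complex.exp_int_mul, hMe w hw, hMe' w hw]
      · push_cast
        linear_combination (m : ℂ) * hn - (n : ℂ) * hm
    have hcl : closure (connectedComponentIn (A ∪ B)ᶜ z) ⊆
        connectedComponentIn (A ∪ B)ᶜ z ∪ (A ∪ B) := by
      intro w hw
      by_contra! hcon
      have hcon := not_or.1 hcon
      obtain ⟨v, hv, hv'⟩ := mem_closure_iff.1 hw (connectedComponentIn (A ∪ B)ᶜ w)
        h.isCompact.isClosed.isOpen_compl.connectedComponentIn (mem_connectedComponentIn hcon.2)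
      apply hcon.1
      rw [connectedComponentIn_eq hv', ← connectedComponentIn_eq hv]
      exact mem_connectedComponentIn hcon.2
    have hne : ∀ w ∈ closure (connectedComponentIn (A ∪ B)ᶜ z), w - y ≠ 0 := by
      intro w hw h0
      rw [sub_eq_zero.1 h0] at hw
      exact (hcl hw).elim hc hy.1
    exact hm0 (eq_zero_of_hasLogOn_frontier h.isCompact.isClosed
      h.isCompact.isClosed.isOpen_compl.connectedComponentIn hz.2 hcl
      (mem_connectedComponentIn hz.1)
      (ContinuousOn.zpow₀ (by fun_prop) _ fun w hw => Or.inl (hne w hw))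
      (fun w hw => zpow_ne_zero _ (hne w hw)) hlog)

lemma innerRegion_nonempty (h : JordanPair A B p q) : (innerRegion (A ∪ B)).Nonempty := by
  classical
  by_contra hempty
  rw [not_nonempty_iff_eq_empty] at hempty
  have heq : ∀ z, z ∉ A → z ∉ B → logVar A p q z = logVar B p q z := fun z hA hB =>
    h.logVar_eq_of_mem_outerRegion
      ((mem_innerRegion_or_mem_outerRegion (by simp [hA, hB])).resolve_left (by simp [hempty]))
  let F : ℂ → ℂ := Aᶜ.piecewise (logVar A p q) (logVar B p q)
  have hFA : EqOn F (logVar A p q) Aᶜ := piecewise_eqOn _ _ _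
  have hFB : EqOn F (logVar B p q) Bᶜ := fun z hz => by
    by_cases hA : z ∈ A
    · exact piecewise_eq_of_notMem _ _ _ (by simpa using hA)
    · rw [hFA hA, heq z hA hz]
  have hF : ∀ z, z ≠ p → z ≠ q →
      ContinuousAt F z ∧ Complex.exp (F z) = (q - z) / (p - z) := by
    intro z hzp hzq
    by_cases hA : z ∈ A
    · have hB : z ∉ B := fun hB => by
        have : z ∈ A ∩ B := ⟨hA, hB⟩
        rw [h.inter_eq] at this
        simp [hzp, hzq] at this
      refine ⟨(continuousAt_logVar h.preconnected_right h.acyclic_right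
        h.compact_right.isClosed h.left_mem.2 h.right_mem.2 hB).congr ?_, ?_⟩
      · exact (hFB.eventuallyEq_of_mem
          (h.compact_right.isClosed.isOpen_compl.mem_nhds hB)).symm
      · rw [hFB hB, exp_logVar h.preconnected_right h.acyclic_right h.left_mem.2
          h.right_mem.2 hB]
    · refine ⟨(continuousAt_logVar h.preconnected_left h.acyclic_left
        h.compact_left.isClosed h.left_mem.1 h.right_mem.1 hA).congr ?_, ?_⟩
      · exact (hFA.eventuallyEq_of_mem
          (h.compact_left.isClosed.isOpen_compl.mem_nhds hA)).symm
      · rw [hFA hA, exp_logVar h.preconnected_left h.acyclic_left h.left_mem.1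
          h.right_mem.1 hA]
  have hd : 0 < ‖q - p‖ := norm_pos_iff.2 (sub_ne_zero.2 h.ne.symm)
  have hr : 0 < ‖q - p‖ / 2 := half_pos hd
  have hS : ∀ z ∈ Metric.sphere p (‖q - p‖ / 2), z ≠ p ∧ z ≠ q := by
    intro z hz
    rw [mem_sphere_iff_norm] at hz
    constructor
    · rintro rfl; simp at hz; linarith
    · rintro rfl; linarith
  have hq : HasLogOn (fun z => q - z) (Metric.sphere p (‖q - p‖ / 2)) := by
    refine ((hasLogOn_const (sub_ne_zero.2 h.ne.symm) _).mul (HasLogOn.of_mem_slitPlane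
      (f := fun z => 1 - (z - p) / (q - p)) (by fun_prop)
      fun z hz => one_sub_mem_slitPlane ?_)).congr ?_
    · rw [norm_div, mem_sphere_iff_norm.1 hz, div_lt_one hd]; linarith
    · intro z _
      have := sub_ne_zero.2 h.ne.symm
      simp only
      field_simp
      ring
  have hF' : HasLogOn (fun z => (q - z) / (p - z)) (Metric.sphere p (‖q - p‖ / 2)) :=
    ⟨F, fun z hz => (hF z (hS z hz).1 (hS z hz).2).1.continuousWithinAt,
      fun z hz => (hF z (hS z hz).1 (hS z hz).2).2⟩
  refine one_ne_zero (eq_zero_of_hasLogOn_sphere (m := 1) hr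
    (((hasLogOn_const (c := -1) (by norm_num) _).mul (hq.div hF')).congr fun z hz => ?_))
  have h1 : q - z ≠ 0 := sub_ne_zero.2 (hS z hz).2.symm
  have h2 : p - z ≠ 0 := sub_ne_zero.2 (hS z hz).1.symm
  simp only [zpow_one]
  field_simp
  ring

lemma subset_closure_innerRegion (h : JordanPair A B p q) :
    A ∪ B ⊆ closure (innerRegion (A ∪ B)) := by
  intro x hx
  rw [mem_closure_iff]
  intro V hV hxV
  by_contra hemp
  rw [not_nonempty_iff_eq_empty, ← disjoint_iff_inter_eq_empty] at hemp
  obtain ⟨D, hD, hDa, hVD, hDJ⟩ := h.exists_acyclic x hx V hV hxV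
  obtain ⟨a, ha⟩ := h.innerRegion_nonempty
  have hJ := h.isCompact.isClosed
  have hcl : closure (innerRegion (A ∪ B)) ⊆ innerRegion (A ∪ B) ∪ D := by
    intro z hz
    rcases closure_innerRegion_subset hJ hz with h1 | h1
    · exact Or.inl h1
    · exact Or.inr (hVD ⟨h1, fun hzV => (hemp.closure_right hV).le_bot ⟨hzV, hz⟩⟩)
  exact one_ne_zero (eq_zero_of_hasLogOn_frontier (m := 1) (h := fun _ => 1) hD
    (isOpen_innerRegion hJ) (isBounded_innerRegion h.isCompact.isBounded) hcl ha
    continuousOn_const (by simp)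
    ((hDa.hasLogOn_sub fun haD => ha.1 (hDJ haD)).congr fun w _ => by simp))

lemma subset_closure_outerRegion (h : JordanPair A B p q) :
    A ∪ B ⊆ closure (outerRegion (A ∪ B)) := by
  intro x hx
  rw [mem_closure_iff]
  intro V hV hxV
  by_contra hemp
  rw [not_nonempty_iff_eq_empty, ← disjoint_iff_inter_eq_empty] at hemp
  obtain ⟨D, hD, hDa, hVD, hDJ⟩ := h.exists_acyclic x hx V hV hxV
  obtain ⟨a, ha⟩ := h.innerRegion_nonempty
  have hJ := h.isCompact.isClosed
  have hout := isOpen_outerRegion hJ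
  obtain ⟨R, hR, hJR⟩ := h.isCompact.isBounded.subset_closedBall_lt 0 0
  have hcl : closure (outerRegion (A ∪ B)) ⊆ outerRegion (A ∪ B) ∪ D := by
    intro z hz
    by_cases h1 : z ∈ A ∪ B
    · exact Or.inr (hVD ⟨h1, fun hzV => (hemp.closure_right hV).le_bot ⟨hzV, hz⟩⟩)
    · refine Or.inl ((mem_innerRegion_or_mem_outerRegion h1).resolve_left fun h2 => ?_)
      obtain ⟨y, hy, hy'⟩ := mem_closure_iff.1 hz _ (isOpen_innerRegion hJ) h2
      exact hy'.2 hy.2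
  have hclosed : IsClosed (outerRegion (A ∪ B) ∪ D) := by
    refine isClosed_of_closure_subset ?_
    rw [closure_union, hD.closure_eq]
    exact union_subset hcl subset_union_right
  refine one_ne_zero (eq_zero_of_hasLogOn_frontier (m := 1) (h := fun _ => 1)
    (U := (outerRegion (A ∪ B) ∪ D)ᶜ) hD hclosed.isOpen_compl ?_ ?_
    (a := a) (fun h1 => h1.elim (fun h2 => h2.2 ha.2) fun h2 => ha.1 (hDJ h2))
    continuousOn_const (by simp)
    ((hDa.hasLogOn_sub fun haD => ha.1 (hDJ haD)).congr fun w _ => by simp))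
  · refine Metric.isBounded_closedBall.subset (t := Metric.closedBall (0 : ℂ) R) fun z hz => ?_
    rw [mem_closedBall_zero_iff]
    by_contra! hlt
    exact hz (Or.inl (mem_outerRegion_of_lt_norm hJR hR.le hlt))
  · intro z hz
    by_cases hzD : z ∈ D
    · exact Or.inr hzD
    · refine Or.inl fun h1 => ?_
      have h2 := h1.resolve_right hzD
      obtain ⟨y, hy, hy'⟩ := mem_closure_iff.1 hz _ hout h2
      exact hy' (Or.inl hy)

end JordanPair

lemma image_Icc_inter_subset {c d : ℝ → ℂ} {a b : ℝ}
    (hout : ∀ t ∈ Ioo a b, c t ∉ range d) {t : ℝ} (ht : t ∈ Icc a b) (htd : c t ∈ range d) :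
    t = a ∨ t = b := by
  by_contra! h
  exact hout t ⟨lt_of_le_of_ne ht.1 h.1.symm, lt_of_le_of_ne ht.2 h.2⟩ htd

/-- Removing a small open subarc from a Jordan curve leaves a log-acyclic set. -/
lemma exists_logAcyclic_of_mem_left {c d : ℝ → ℂ} (hc : IsEmbedding c) (hd : IsEmbedding d)
    {a b a' b' : ℝ} (hab : a < b) (hab' : a' < b') (ha : c a = d a') (hb : c b = d b')
    (hout : ∀ t ∈ Ioo a b, c t ∉ range d) {x : ℂ} (hx : x ∈ c '' Icc a b) {V : Set ℂ}
    (hV : IsOpen V) (hxV : x ∈ V) :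
    ∃ D, IsClosed D ∧ LogAcyclic D ∧ (c '' Icc a b ∪ d '' Icc a' b') \ V ⊆ D ∧
      D ⊆ c '' Icc a b ∪ d '' Icc a' b' := by
  obtain ⟨t, ht, rfl⟩ := hx
  rw [← closure_Ioo hab.ne] at ht
  obtain ⟨t₀, ht₀V, ht₀⟩ := mem_closure_iff.1 ht _ (hV.preimage hc.continuous) hxV
  obtain ⟨u, v, ⟨hu, hv⟩, huv⟩ := mem_nhds_iff_exists_Ioo_subset.1
    (((hV.preimage hc.continuous).inter isOpen_Ioo).mem_nhds ⟨ht₀V, ht₀⟩)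
  obtain ⟨hau, hvb⟩ := (Ioo_subset_Ioo_iff (hu.trans hv)).1 (huv.trans inter_subset_right)
  have hcl : ∀ {f : ℝ → ℂ} (s t : ℝ), IsEmbedding f → IsClosed (f '' Icc s t) := fun s t hf =>
    (isCompact_Icc.image hf.continuous).isClosed
  have huv' : u < v := hu.trans hv
  have h1 : d '' Icc a' b' ∩ c '' Icc a u = {c a} := by
    refine Subset.antisymm ?_ (singleton_subset_iff.2
      ⟨⟨a', left_mem_Icc.2 hab'.le, ha.symm⟩, ⟨a, left_mem_Icc.2 hau, rfl⟩⟩)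
    rintro _ ⟨⟨s, hs, hst⟩, ⟨t, ht, rfl⟩⟩
    rcases image_Icc_inter_subset hout ⟨ht.1, by linarith [ht.2]⟩ ⟨s, hst⟩ with h | h
    · rw [h]; rfl
    · linarith [ht.2]
  have h2 : (d '' Icc a' b' ∪ c '' Icc a u) ∩ c '' Icc v b = {c b} := by
    refine Subset.antisymm ?_ (singleton_subset_iff.2
      ⟨Or.inl ⟨b', right_mem_Icc.2 hab'.le, hb.symm⟩, ⟨b, right_mem_Icc.2 hvb, rfl⟩⟩)
    rintro _ ⟨⟨s, hs, hst⟩ | ⟨s, hs, hst⟩, ⟨t, ht, rfl⟩⟩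
    · rcases image_Icc_inter_subset hout ⟨by linarith [ht.1], ht.2⟩ ⟨s, hst⟩
        with h | h
      · linarith [ht.1]
      · rw [h]; rfl
    · have := hc.injective hst
      linarith [ht.1, hs.2]
  refine ⟨(d '' Icc a' b' ∪ c '' Icc a u) ∪ c '' Icc v b,
    ((hcl _ _ hd).union (hcl _ _ hc)).union (hcl _ _ hc), ?_, ?_, ?_⟩
  · exact ((logAcyclic_image_Icc hd hab'.le).union (logAcyclic_image_Icc hc hau) (hcl _ _ hd)
      (hcl _ _ hc) h1).union (logAcyclic_image_Icc hc hvb) ((hcl _ _ hd).union (hcl _ _ hc))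
      (hcl _ _ hc) h2
  · rintro _ ⟨⟨t, ht, rfl⟩ | hz, hzV⟩
    · rcases le_or_gt t u with h | h
      · exact Or.inl (Or.inr ⟨t, ⟨ht.1, h⟩, rfl⟩)
      · rcases le_or_gt v t with h' | h'
        · exact Or.inr ⟨t, ⟨h', ht.2⟩, rfl⟩
        · exact absurd (huv ⟨h, h'⟩).1 hzV
    · exact Or.inl (Or.inl hz)
  · refine union_subset (union_subset subset_union_right ?_) ?_
    · exact (image_mono (Icc_subset_Icc_right (by linarith))).trans subset_union_left
    · exact (image_mono (Icc_subset_Icc_left (by linarith))).trans subset_union_left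

lemma jordanPair_of_isEmbedding {c d : ℝ → ℂ} (hc : IsEmbedding c) (hd : IsEmbedding d)
    {a b a' b' : ℝ} (hab : a < b) (hab' : a' < b') (ha : c a = d a') (hb : c b = d b')
    (hout : ∀ t ∈ Ioo a b, c t ∉ range d) (hout' : ∀ t ∈ Ioo a' b', d t ∉ range c) :
    JordanPair (c '' Icc a b) (d '' Icc a' b') (c a) (c b) where
  compact_left := isCompact_Icc.image hc.continuous
  compact_right := isCompact_Icc.image hd.continuous
  preconnected_left := isPreconnected_Icc.image _ hc.continuous.continuousOn
  preconnected_right := isPreconnected_Icc.image _ hd.continuous.continuousOn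
  acyclic_left := logAcyclic_image_Icc hc hab.le
  acyclic_right := logAcyclic_image_Icc hd hab'.le
  inter_eq := by
    refine Subset.antisymm ?_ (insert_subset ?_ (singleton_subset_iff.2 ?_))
    · rintro _ ⟨⟨t, ht, rfl⟩, ⟨s, -, hs⟩⟩
      rcases image_Icc_inter_subset hout ht ⟨s, hs⟩ with rfl | rfl <;> simp
    · exact ⟨⟨a, left_mem_Icc.2 hab.le, rfl⟩, ⟨a', left_mem_Icc.2 hab'.le, ha.symm⟩⟩
    · exact ⟨⟨b, right_mem_Icc.2 hab.le, rfl⟩, ⟨b', right_mem_Icc.2 hab'.le, hb.symm⟩⟩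
  ne := fun h => hab.ne (hc.injective h)
  exists_acyclic := by
    rintro x (hx | hx) V hV hxV
    · exact exists_logAcyclic_of_mem_left hc hd hab hab' ha hb hout hx hV hxV
    · rw [union_comm]
      exact exists_logAcyclic_of_mem_left hd hc hab' hab ha.symm hb.symm hout' hx hV hxV

/-- If two embedded rays coincide, then so do their subrays. -/
lemma exists_image_Iic_eq {c d : ℝ → ℂ} (hc : IsEmbedding c) (hd : IsEmbedding d) {a a' : ℝ}
    (h : c '' Iic a = d '' Iic a') {T : ℝ} (hT : T ≤ a) :
    ∃ T' ≤ a', c T = d T' ∧ c '' Iic T = d '' Iic T' := by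
  have hmem : ∀ t ∈ Iic a, ∃ s ∈ Iic a', d s = c t := fun t ht => by
    have : c t ∈ d '' Iic a' := h ▸ mem_image_of_mem c ht
    exact this
  choose! φ hφ hdφ using hmem
  have hsurj : ∀ s ≤ a', ∃ t ≤ a, φ t = s := fun s hs => by
    have : d s ∈ c '' Iic a := h ▸ mem_image_of_mem d (show s ∈ Iic a' from hs)
    obtain ⟨t, ht, hts⟩ := this
    exact ⟨t, ht, hd.injective (by rw [hdφ t ht, hts])⟩
  have hcont : ContinuousOn φ (Iic a) := by
    rw [hd.continuousOn_iff]
    exact hc.continuous.continuousOn.congr hdφ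
  have hinj : InjOn φ (Iic a) := fun s hs t ht hst =>
    hc.injective (by rw [← hdφ s hs, ← hdφ t ht, hst])
  have hmono : StrictMonoOn φ (Iic a) := by
    intro x hx y hy hxy
    obtain ⟨s, hs, hφs⟩ := hsurj (φ a - 1) (by linarith [mem_Iic.1 (hφ a (mem_Iic.2 le_rfl))])
    have hm : min s x ≤ a := (min_le_left _ _).trans hs
    have hsub : Icc (min s x) a ⊆ Iic a := fun t ht => ht.2
    rcases (hcont.mono hsub).strictMonoOn_of_injOn_Icc' hm (hinj.mono hsub) with h' | h'
    · exact h' ⟨min_le_right _ _, hx⟩ ⟨(min_le_right _ _).trans hxy.le, hy⟩ hxy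
    · have h2 := h'.antitoneOn ⟨min_le_left s x, hs⟩ ⟨hm, le_rfl⟩ hs
      linarith
  refine ⟨φ T, hφ T hT, (hdφ T hT).symm, Subset.antisymm ?_ ?_⟩
  · rintro _ ⟨t, ht, rfl⟩
    have hta : t ≤ a := le_trans ht hT
    exact ⟨φ t, hmono.monotoneOn hta hT ht, hdφ t hta⟩
  · rintro _ ⟨s, hs, rfl⟩
    obtain ⟨t, ht, rfl⟩ := hsurj s (le_trans hs (hφ T hT))
    exact ⟨t, (hmono.le_iff_le ht hT).1 hs, (hdφ t ht).symm⟩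

lemma isEmbedding_comp_neg {c : ℝ → ℂ} (hc : IsEmbedding c) : IsEmbedding fun t => c (-t) :=
  hc.comp (Homeomorph.neg ℝ).isEmbedding

lemma image_neg_Iic (c : ℝ → ℂ) (a : ℝ) : (fun t => c (-t)) '' Iic (-a) = c '' Ici a := by
  ext z; constructor
  · rintro ⟨t, ht, rfl⟩; exact ⟨-t, by simp only [mem_Iic, mem_Ici] at *; linarith, rfl⟩
  · rintro ⟨t, ht, rfl⟩; exact ⟨-t, by simp only [mem_Iic, mem_Ici] at *; linarith, by simp⟩

lemma image_neg_Ici (c : ℝ → ℂ) (a : ℝ) : (fun t => c (-t)) '' Ici (-a) = c '' Iic a := by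
  ext z; constructor
  · rintro ⟨t, ht, rfl⟩; exact ⟨-t, by simp only [mem_Iic, mem_Ici] at *; linarith, rfl⟩
  · rintro ⟨t, ht, rfl⟩; exact ⟨-t, by simp only [mem_Iic, mem_Ici] at *; linarith, by simp⟩

lemma exists_image_Ici_eq {c d : ℝ → ℂ} (hc : IsEmbedding c) (hd : IsEmbedding d) {b b' : ℝ}
    (h : c '' Ici b = d '' Ici b') {S : ℝ} (hS : b ≤ S) :
    ∃ S' ≥ b', c S = d S' ∧ c '' Ici S = d '' Ici S' := by
  rw [← image_neg_Iic, ← image_neg_Iic] at h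
  obtain ⟨T', hT', h1, h2⟩ := exists_image_Iic_eq (isEmbedding_comp_neg hc)
    (isEmbedding_comp_neg hd) h (T := -S) (by linarith)
  refine ⟨-T', by linarith, by simpa using h1, ?_⟩
  rw [← image_neg_Iic, ← image_neg_Iic, h2, neg_neg]

lemma image_subset_or_image_subset {c d : ℝ → ℂ} (hc : IsEmbedding c) (hd : IsEmbedding d)
    {a' b' : ℝ} (hab' : a' < b') (hd' : {t | d t ∉ range c} = Ioo a' b') {S : Set ℝ}
    (hS : IsPreconnected S) (hcS : c '' S ⊆ range d) :
    c '' S ⊆ d '' Iic a' ∨ c '' S ⊆ d '' Ici b' := by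
  have hmem : ∀ t ∈ S, ∃ s, d s = c t := fun t ht => hcS (mem_image_of_mem c ht)
  choose! φ hφ using hmem
  have hcont : ContinuousOn φ S := by
    rw [hd.continuousOn_iff]
    exact hc.continuous.continuousOn.congr hφ
  have hside : ∀ t ∈ S, φ t ≤ a' ∨ b' ≤ φ t := fun t ht => by
    by_contra! h
    have : φ t ∈ {t | d t ∉ range c} := by rw [hd']; exact h
    exact this ⟨t, (hφ t ht).symm⟩
  obtain ⟨m, ham, hmb⟩ := exists_between hab'
  rcases (hS.image φ hcont).subset_or_subset (u := Iio m) (v := Ioi m) isOpen_Iio isOpen_Ioi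
    (disjoint_left.2 fun x hx hx' => lt_asymm (mem_Iio.1 hx) (mem_Ioi.1 hx')) (by
      rintro _ ⟨t, ht, rfl⟩
      exact (hside t ht).imp (fun h => h.trans_lt ham) fun h => hmb.trans_le h) with h | h
  · left
    rintro _ ⟨t, ht, rfl⟩
    refine ⟨φ t, (hside t ht).resolve_right fun hb => ?_, hφ t ht⟩
    have : φ t < m := h (mem_image_of_mem φ ht)
    linarith
  · right
    rintro _ ⟨t, ht, rfl⟩
    refine ⟨φ t, (hside t ht).resolve_left fun hb => ?_, hφ t ht⟩
    have : m < φ t := h (mem_image_of_mem φ ht)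
    linarith

lemma image_union_image_eq_inter {c d : ℝ → ℂ} {a b : ℝ}
    (hc' : {t | c t ∉ range d} = Ioo a b) :
    c '' Iic a ∪ c '' Ici b = range c ∩ range d := by
  have hiff : ∀ t, c t ∈ range d ↔ t ≤ a ∨ b ≤ t := fun t => by
    have : t ∈ {t | c t ∉ range d} ↔ t ∈ Ioo a b := by rw [hc']
    simp only [mem_ofPred_eq, mem_Ioo] at this
    rw [← not_iff_not, this]; push Not; rfl
  ext z; constructor
  · rintro (⟨t, ht, rfl⟩ | ⟨t, ht, rfl⟩)
    · exact ⟨⟨t, rfl⟩, (hiff t).2 (Or.inl ht)⟩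
    · exact ⟨⟨t, rfl⟩, (hiff t).2 (Or.inr ht)⟩
  · rintro ⟨⟨t, rfl⟩, ht⟩
    exact ((hiff t).1 ht).imp (fun h => ⟨t, h, rfl⟩) fun h => ⟨t, h, rfl⟩

lemma disjoint_image_Iic_image_Ici {c : ℝ → ℂ} (hc : Function.Injective c) {a b : ℝ}
    (hab : a < b) : Disjoint (c '' Iic a) (c '' Ici b) := by
  rw [disjoint_image_iff hc, disjoint_left]
  intro t h1 h2
  simp only [mem_Iic, mem_Ici] at h1 h2
  linarith

/-- Two lines which differ by portions have the same pair of ends. -/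
lemma rays_eq {c d : ℝ → ℂ} (hc : IsEmbedding c) (hd : IsEmbedding d) {a b a' b' : ℝ}
    (hab' : a' < b') (hc' : {t | c t ∉ range d} = Ioo a b)
    (hd' : {t | d t ∉ range c} = Ioo a' b') :
    (c '' Iic a = d '' Iic a' ∧ c '' Ici b = d '' Ici b') ∨
      (c '' Iic a = d '' Ici b' ∧ c '' Ici b = d '' Iic a') := by
  have hu := image_union_image_eq_inter hc'
  have hu' := image_union_image_eq_inter hd'
  rw [inter_comm, ← hu] at hu'
  have hdisj := disjoint_image_Iic_image_Ici hd.injective hab'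
  have hL : (d '' Iic a').Nonempty := nonempty_Iic.image d
  have hR : (d '' Ici b').Nonempty := nonempty_Ici.image d
  have hrange : ∀ S, c '' S ⊆ c '' Iic a ∪ c '' Ici b → c '' S ⊆ range d := fun S hS =>
    (hS.trans hu.le).trans inter_subset_right
  have h1 := image_subset_or_image_subset hc hd hab' hd' isPreconnected_Iic
    (hrange _ subset_union_left)
  have h2 := image_subset_or_image_subset hc hd hab' hd' isPreconnected_Ici
    (hrange _ subset_union_right)
  generalize c '' Iic a = P at *
  generalize c '' Ici b = Q at *
  generalize d '' Iic a' = P' at *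
  generalize d '' Ici b' = Q' at *
  rw [disjoint_left] at hdisj
  have hmem : ∀ z, (z ∈ P' ∨ z ∈ Q') ↔ (z ∈ P ∨ z ∈ Q) := fun z => by
    rw [← mem_union, ← mem_union, hu']
  rcases h1 with h1 | h1 <;> rcases h2 with h2 | h2
  · obtain ⟨z, hz⟩ := hR
    exact absurd hz (hdisj (((hmem z).1 (Or.inr hz)).elim (fun h => h1 h) fun h => h2 h))
  · left
    refine ⟨h1.antisymm fun z hz => ?_, h2.antisymm fun z hz => ?_⟩
    · exact ((hmem z).1 (Or.inl hz)).resolve_right fun h => hdisj hz (h2 h)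
    · exact ((hmem z).1 (Or.inr hz)).resolve_left fun h => hdisj (h1 h) hz
  · right
    refine ⟨h1.antisymm fun z hz => ?_, h2.antisymm fun z hz => ?_⟩
    · exact ((hmem z).1 (Or.inr hz)).resolve_right fun h => hdisj (h2 h) hz
    · exact ((hmem z).1 (Or.inl hz)).resolve_left fun h => hdisj hz (h1 h)
  · obtain ⟨z, hz⟩ := hL
    exact absurd (((hmem z).1 (Or.inl hz)).elim (fun h => h1 h) fun h => h2 h) (hdisj hz)

/-- In every parametrization of `γ`, the points outside `γ'` form a bounded open interval. -/
def DiffersByPortion (γ γ' : Set ℂ) : Prop :=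
  ∀ c : ℝ → ℂ, IsEmbedding c → range c = γ → ∃ a b, {t | c t ∉ γ'} = Ioo a b

lemma lt_of_differsByPortion {c d : ℝ → ℂ} (hc : IsEmbedding c) (hd : IsEmbedding d)
    (hne : range c ≠ range d) {a b a' b' : ℝ} (hc' : {t | c t ∉ range d} = Ioo a b)
    (hd' : {t | d t ∉ range c} = Ioo a' b') : a < b := by
  by_contra! hba
  rw [Ioo_eq_empty hba.not_gt] at hc'
  have hcd : range c ⊆ range d := by
    rintro _ ⟨t, rfl⟩
    by_contra h
    exact (hc' ▸ (show t ∈ {t | c t ∉ range d} from h) : t ∈ (∅ : Set ℝ))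
  have hab' : a' < b' := by
    by_contra! hba'
    rw [Ioo_eq_empty hba'.not_gt] at hd'
    refine hne (hcd.antisymm ?_)
    rintro _ ⟨t, rfl⟩
    by_contra h
    exact (hd' ▸ (show t ∈ {t | d t ∉ range c} from h) : t ∈ (∅ : Set ℝ))
  have hu := image_union_image_eq_inter hd'
  have hdisj := disjoint_left.1 (disjoint_image_Iic_image_Ici hd.injective hab')
  have hsub : d '' Iic a' ∪ d '' Ici b' ⊆ c '' univ := by
    rw [hu, image_univ]; exact inter_subset_right
  rcases image_subset_or_image_subset hc hd hab' hd' isPreconnected_univ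
    (by rwa [image_univ]) with h | h
  · exact hdisj (h (hsub (Or.inr ⟨b', self_mem_Ici, rfl⟩))) ⟨b', self_mem_Ici, rfl⟩
  · exact hdisj ⟨a', self_mem_Iic, rfl⟩ (h (hsub (Or.inl ⟨a', self_mem_Iic, rfl⟩)))

/-- A parametrization of `γ` which traverses the end `N` up to the point `p` at time `T` and
the end `P` from the point `q` on at time `S`. -/
structure IsParam (N P : Set ℂ) (p q : ℂ) (γ : Set ℂ) (c : ℝ → ℂ) (T S : ℝ) : Prop where
  isEmbedding : IsEmbedding c
  range_eq : range c = γ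
  left_eq : c T = p
  right_eq : c S = q
  image_Iic : c '' Iic T = N
  image_Ici : c '' Ici S = P

lemma exists_isParam {γ γ' : Set ℂ} {c d : ℝ → ℂ} (hc : IsEmbedding c) (hcγ : range c = γ)
    (hd : IsEmbedding d) (hdγ : range d = γ') (hne : γ ≠ γ') (h : DiffersByPortion γ γ')
    (h' : DiffersByPortion γ' γ) :
    ∃ a b, ∀ T ≤ a, ∀ S ≥ b, ∃ d' T' S',
      IsParam (c '' Iic T) (c '' Ici S) (c T) (c S) γ' d' T' S' := by
  obtain ⟨a, b, hc'⟩ := h c hc hcγ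
  obtain ⟨a', b', hd'⟩ := h' d hd hdγ
  subst hcγ hdγ
  have hab' := lt_of_differsByPortion hd hc hne.symm hd' hc'
  refine ⟨a, b, fun T hT S hS => ?_⟩
  rcases rays_eq hc hd hab' hc' hd' with ⟨h1, h2⟩ | ⟨h1, h2⟩
  · obtain ⟨T', -, hT1, hT2⟩ := exists_image_Iic_eq hc hd h1 hT
    obtain ⟨S', -, hS1, hS2⟩ := exists_image_Ici_eq hc hd h2 hS
    exact ⟨d, T', S', hd, rfl, hT1.symm, hS1.symm, hT2.symm, hS2.symm⟩
  · have hd₁ := isEmbedding_comp_neg hd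
    rw [← image_neg_Iic] at h1
    rw [← image_neg_Ici] at h2
    obtain ⟨T', -, hT1, hT2⟩ := exists_image_Iic_eq hc hd₁ h1 hT
    obtain ⟨S', -, hS1, hS2⟩ := exists_image_Ici_eq hc hd₁ h2 hS
    exact ⟨_, T', S', hd₁, (Homeomorph.neg ℝ).surjective.range_comp d, hT1.symm, hS1.symm,
      hT2.symm, hS2.symm⟩

/-- The parametrizations `c` and `d` agree as paths except on the intervals `(a, b)` and
`(a', b')`, where each leaves the range of the other. -/
structure Detour (c d : ℝ → ℂ) (a b a' b' : ℝ) : Prop where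
  lt_left : a < b
  lt_right : a' < b'
  out_left : {t | c t ∉ range d} = Ioo a b
  out_right : {t | d t ∉ range c} = Ioo a' b'
  start_eq : c a = d a'
  finish_eq : c b = d b'
  image_Iic : c '' Iic a = d '' Iic a'
  image_Ici : c '' Ici b = d '' Ici b'

section

variable {N P : Set ℂ} {p q : ℂ} {γ γ' : Set ℂ} {c d : ℝ → ℂ} {T S T' S' : ℝ}

lemma IsParam.le_of_image_subset (hc : IsParam N P p q γ c T S) {a b : ℝ} (hab : a < b)
    (h : {t | c t ∉ γ'} = Ioo a b) (hN : N ⊆ γ') (hP : P ⊆ γ') : T ≤ a ∧ b ≤ S := by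
  constructor
  · by_contra! hlt
    obtain ⟨t, ht, ht'⟩ := exists_between (lt_min hlt hab)
    have : t ∈ {t | c t ∉ γ'} := by rw [h]; exact ⟨ht, ht'.trans_le (min_le_right _ _)⟩
    exact this (hN (hc.image_Iic ▸ ⟨t, (ht'.trans_le (min_le_left _ _)).le, rfl⟩))
  · by_contra! hlt
    obtain ⟨t, ht, ht'⟩ := exists_between (max_lt hlt hab)
    have : t ∈ {t | c t ∉ γ'} := by rw [h]; exact ⟨(le_max_right _ _).trans_lt ht, ht'⟩
    exact this (hP (hc.image_Ici ▸ ⟨t, ((le_max_left _ _).trans_lt ht).le, rfl⟩))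

lemma IsParam.left_subset (hc : IsParam N P p q γ c T S) : N ⊆ γ := by
  rw [← hc.image_Iic, ← hc.range_eq]; exact image_subset_range _ _

lemma IsParam.right_subset (hc : IsParam N P p q γ c T S) : P ⊆ γ := by
  rw [← hc.image_Ici, ← hc.range_eq]; exact image_subset_range _ _

lemma IsParam.exists_detour (hc : IsParam N P p q γ c T S) (hd : IsParam N P p q γ' d T' S')
    (hne : γ ≠ γ') (h : DiffersByPortion γ γ') (h' : DiffersByPortion γ' γ) :
    ∃ a b a' b', Detour c d a b a' b' ∧ (T ≤ a ∧ b ≤ S) ∧ (T' ≤ a' ∧ b' ≤ S') := by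
  obtain ⟨a, b, hc'⟩ := h c hc.isEmbedding hc.range_eq
  obtain ⟨a', b', hd'⟩ := h' d hd.isEmbedding hd.range_eq
  have hc'' := hc'
  have hd'' := hd'
  rw [← hd.range_eq] at hc''
  rw [← hc.range_eq] at hd''
  rw [← hc.range_eq, ← hd.range_eq] at hne
  have hab := lt_of_differsByPortion hc.isEmbedding hd.isEmbedding hne hc'' hd''
  have hab' := lt_of_differsByPortion hd.isEmbedding hc.isEmbedding hne.symm hd'' hc''
  have hTS := hc.le_of_image_subset hab hc' hd.left_subset hd.right_subset
  have hTS' := hd.le_of_image_subset hab' hd' hc.left_subset hc.right_subset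
  refine ⟨a, b, a', b', ?_, hTS, hTS'⟩
  rcases rays_eq hc.isEmbedding hd.isEmbedding hab' hc'' hd'' with ⟨h1, h2⟩ | ⟨h1, -⟩
  · obtain ⟨x, hx, hx1, hx2⟩ := exists_image_Iic_eq hc.isEmbedding hd.isEmbedding h1 le_rfl
    obtain ⟨y, hy, hy1, hy2⟩ := exists_image_Ici_eq hc.isEmbedding hd.isEmbedding h2 le_rfl
    rw [h1, hd.isEmbedding.injective.image_injective.eq_iff, Iic_inj] at hx2
    rw [h2, hd.isEmbedding.injective.image_injective.eq_iff, Ici_inj] at hy2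
    subst hx2 hy2
    exact ⟨hab, hab', hc'', hd'', hx1, hy1, h1, h2⟩
  · have : d T' ∈ d '' Ici b' := by
      rw [← h1, hd.left_eq, ← hc.left_eq]; exact ⟨T, hTS.1, rfl⟩
    obtain ⟨t, ht, htT⟩ := this
    have := hd.isEmbedding.injective htT
    linarith [mem_Ici.1 ht, hTS'.1]

end

lemma image_Icc_eq_insert_left {c : ℝ → ℂ} (hc : Function.Injective c) {T a : ℝ} (h : T ≤ a) :
    c '' Icc T a = insert (c T) (c '' Iic a \ c '' Iic T) := by
  rw [← image_sdiff hc, ← image_insert_eq]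
  congr 1
  ext t
  simp only [mem_Icc, mem_insert_iff, mem_sdiff, mem_Iic, not_le]
  grind

lemma image_Icc_eq_insert_right {c : ℝ → ℂ} (hc : Function.Injective c) {b S : ℝ} (h : b ≤ S) :
    c '' Icc b S = insert (c S) (c '' Ici b \ c '' Ici S) := by
  rw [← image_sdiff hc, ← image_insert_eq]
  congr 1
  ext t
  simp only [mem_Icc, mem_insert_iff, mem_sdiff, mem_Ici, not_le]
  grind

lemma range_diff_range_eq {c d : ℝ → ℂ} {a b : ℝ} (h : {t | c t ∉ range d} = Ioo a b) :
    range c \ range d = c '' Ioo a b := by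
  rw [← h]
  ext z; constructor
  · rintro ⟨⟨t, rfl⟩, ht⟩; exact ⟨t, ht, rfl⟩
  · rintro ⟨t, ht, rfl⟩; exact ⟨⟨t, rfl⟩, ht⟩

lemma closure_image_Ioo {c : ℝ → ℂ} (hc : Continuous c) {a b : ℝ} (hab : a < b) :
    closure (c '' Ioo a b) = c '' Icc a b := by
  refine Subset.antisymm (closure_minimal (image_mono Ioo_subset_Icc_self)
    (isCompact_Icc.image hc).isClosed) ?_
  rw [← closure_Ioo hab.ne]
  exact image_closure_subset_closure_image hc

namespace Detour

variable {c d : ℝ → ℂ} {a b a' b' : ℝ}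

lemma closure_symmDiff (h : Detour c d a b a' b') (hc : IsEmbedding c) (hd : IsEmbedding d) :
    closure (symmDiff (range c) (range d)) = c '' Icc a b ∪ d '' Icc a' b' := by
  rw [symmDiff_def, show ∀ s t : Set ℂ, s ⊔ t = s ∪ t from fun _ _ => rfl,
    closure_union, range_diff_range_eq h.out_left, range_diff_range_eq h.out_right,
    closure_image_Ioo hc.continuous h.lt_left, closure_image_Ioo hd.continuous h.lt_right]

lemma jordanPair (h : Detour c d a b a' b') (hc : IsEmbedding c) (hd : IsEmbedding d) :
    JordanPair (c '' Icc a b) (d '' Icc a' b') (c a) (c b) :=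
  jordanPair_of_isEmbedding hc hd h.lt_left h.lt_right h.start_eq h.finish_eq
    (fun _ ht => h.out_left.ge ht) fun _ ht => h.out_right.ge ht

end Detour

lemma logVar_image_Icc_add {c : ℝ → ℂ} (hc : IsEmbedding c) {r s t : ℝ} (hrs : r ≤ s)
    (hst : s ≤ t) {z : ℂ} (hz : z ∉ c '' Icc r t) :
    logVar (c '' Icc r t) (c r) (c t) z =
      logVar (c '' Icc r s) (c r) (c s) z + logVar (c '' Icc s t) (c s) (c t) z := by
  have hun : c '' Icc r t = c '' Icc r s ∪ c '' Icc s t := by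
    rw [← image_union, Icc_union_Icc_eq_Icc hrs hst]
  have hl := (logAcyclic_image_Icc hc (hrs.trans hst)).hasLogOn_sub hz
  rw [hun] at hl ⊢
  exact logVar_union (isPreconnected_Icc.image _ hc.continuous.continuousOn)
    (isPreconnected_Icc.image _ hc.continuous.continuousOn) ⟨r, left_mem_Icc.2 hrs, rfl⟩
    ⟨s, right_mem_Icc.2 hrs, rfl⟩ ⟨s, left_mem_Icc.2 hst, rfl⟩ ⟨t, right_mem_Icc.2 hst, rfl⟩ hl

/-- The heights of two lines outside their arcs differ exactly in the inner region. -/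
structure HeightPair (D γ γ' : Set ℂ) (h h' : ℂ → ℝ) : Prop where
  disjoint : Disjoint (closure (symmDiff γ γ')) D
  subset_union : closure (symmDiff γ γ') ⊆ γ ∪ γ'
  subset_closure_inner :
    closure (symmDiff γ γ') ⊆ closure (innerRegion (closure (symmDiff γ γ')))
  subset_closure_outer :
    closure (symmDiff γ γ') ⊆ closure (outerRegion (closure (symmDiff γ γ')))
  eq_of_outer : ∀ z ∈ D, z ∈ outerRegion (closure (symmDiff γ γ')) → h z = h' z
  ne_of_inner : ∀ z ∈ D, z ∈ innerRegion (closure (symmDiff γ γ')) → h z ≠ h' z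
  total : (∀ z ∈ D, h z ≤ h' z) ∨ ∀ z ∈ D, h' z ≤ h z

lemma HeightPair.symm {D γ γ' : Set ℂ} {h h' : ℂ → ℝ} (H : HeightPair D γ γ' h h') :
    HeightPair D γ' γ h' h := by
  have hJ := symmDiff_comm γ' γ
  constructor <;> try rw [hJ]
  exacts [H.disjoint, union_comm γ γ' ▸ H.subset_union, H.subset_closure_inner,
    H.subset_closure_outer, fun z hz hz' => (H.eq_of_outer z hz hz').symm,
    fun z hz hz' => (H.ne_of_inner z hz hz').symm,
    H.total.symm]

lemma HeightPair.neg {D γ γ' : Set ℂ} {h h' : ℂ → ℝ} (H : HeightPair D γ γ' h h') :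
    HeightPair D γ γ' (-h) (-h') :=
  ⟨H.disjoint, H.subset_union, H.subset_closure_inner, H.subset_closure_outer,
    fun z hz hz' => neg_inj.2 (H.eq_of_outer z hz hz'),
    fun z hz hz' => fun e => H.ne_of_inner z hz hz' (neg_inj.1 e),
    H.total.symm.imp (fun h z hz => neg_le_neg (h z hz)) fun h z hz => neg_le_neg (h z hz)⟩

/-- The imaginary part of the variation of the logarithm along a parametrized arc. -/
noncomputable def height (c : ℝ → ℂ) (T S : ℝ) (z : ℂ) : ℝ :=
  (logVar (c '' Icc T S) (c T) (c S) z).im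

lemma JordanPair.im_le_or_le {A B : Set ℂ} {p q : ℂ} (H : JordanPair A B p q) :
    (∀ z ∉ A ∪ B, (logVar A p q z).im ≤ (logVar B p q z).im) ∨
      ∀ z ∉ A ∪ B, (logVar B p q z).im ≤ (logVar A p q z).im := by
  obtain ⟨y, hy⟩ := H.innerRegion_nonempty
  have key : ∀ z ∉ A ∪ B, (logVar A p q z).im = (logVar B p q z).im ∨
      (logVar A p q z).im - (logVar B p q z).im = (logVar A p q y).im - (logVar B p q y).im := by
    intro z hz
    rcases mem_innerRegion_or_mem_outerRegion hz with h | h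
    · right
      rw [← Complex.sub_im, ← Complex.sub_im, H.logVar_sub_eq h hy]
    · left; rw [H.logVar_eq_of_mem_outerRegion h]
  rcases le_total (logVar A p q y).im (logVar B p q y).im with h | h
  · left; intro z hz; rcases key z hz with e | e <;> linarith
  · right; intro z hz; rcases key z hz with e | e <;> linarith

lemma JordanPair.im_ne_of_mem_innerRegion {A B : Set ℂ} {p q z : ℂ} (H : JordanPair A B p q)
    (hz : z ∈ innerRegion (A ∪ B)) : (logVar A p q z).im ≠ (logVar B p q z).im := by
  intro he
  obtain ⟨n, hn⟩ := H.exists_int hz.1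
  refine H.logVar_ne_of_mem_innerRegion hz ?_
  have : (n : ℝ) * (2 * Real.pi) = 0 := by
    have := congrArg Complex.im hn
    rw [he] at this
    simpa [Real.pi_ne_zero] using this
  have hn0 : n = 0 := by
    simpa [Real.pi_ne_zero] using this
  simpa [hn0] using hn

lemma IsParam.heightPair {N P : Set ℂ} {p q : ℂ} {γ γ' : Set ℂ} {c d : ℝ → ℂ} {T S T' S' : ℝ}
    (hc : IsParam N P p q γ c T S) (hd : IsParam N P p q γ' d T' S')
    (hne : γ ≠ γ') (h : DiffersByPortion γ γ') (h' : DiffersByPortion γ' γ) {D : Set ℂ}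
    (hDc : Disjoint (c '' Icc T S) D) (hDd : Disjoint (d '' Icc T' S') D) :
    HeightPair D γ γ' (height c T S) (height d T' S') := by
  obtain ⟨a, b, a', b', hdet, ⟨hTa, hbS⟩, hTa', hbS'⟩ := hc.exists_detour hd hne h h'
  have hce := hc.isEmbedding
  have hde := hd.isEmbedding
  have hJ : closure (symmDiff γ γ') = c '' Icc a b ∪ d '' Icc a' b' := by
    rw [← hc.range_eq, ← hd.range_eq, hdet.closure_symmDiff hce hde]
  have hJP := hdet.jordanPair hce hde
  have hdisj : Disjoint (c '' Icc a b ∪ d '' Icc a' b') D :=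
    disjoint_union_left.2 ⟨hDc.mono_left (image_mono (Icc_subset_Icc hTa hbS)),
      hDd.mono_left (image_mono (Icc_subset_Icc hTa' hbS'))⟩
  have hdiff : ∀ z ∈ D, height c T S z - height d T' S' z =
      (logVar (c '' Icc a b) (c a) (c b) z).im - (logVar (d '' Icc a' b') (c a) (c b) z).im := by
    intro z hz
    have hzc : z ∉ c '' Icc T S := disjoint_right.1 hDc hz
    have hzd : z ∉ d '' Icc T' S' := disjoint_right.1 hDd hz
    have hzc' : z ∉ c '' Icc T b := fun hm => hzc (image_mono (Icc_subset_Icc_right hbS) hm)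
    have hzd' : z ∉ d '' Icc T' b' := fun hm => hzd (image_mono (Icc_subset_Icc_right hbS') hm)
    have e1 : c '' Icc T a = d '' Icc T' a' := by
      rw [image_Icc_eq_insert_left hce.injective hTa, image_Icc_eq_insert_left hde.injective hTa',
        hc.left_eq, hd.left_eq, hdet.image_Iic, hc.image_Iic, hd.image_Iic]
    have e2 : c '' Icc b S = d '' Icc b' S' := by
      rw [image_Icc_eq_insert_right hce.injective hbS, image_Icc_eq_insert_right hde.injective hbS',
        hc.right_eq, hd.right_eq, hdet.image_Ici, hc.image_Ici, hd.image_Ici]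
    rw [height, height,
      logVar_image_Icc_add hce (hTa.trans hdet.lt_left.le) hbS hzc,
      logVar_image_Icc_add hde (hTa'.trans hdet.lt_right.le) hbS' hzd,
      logVar_image_Icc_add hce hTa hdet.lt_left.le hzc',
      logVar_image_Icc_add hde hTa' hdet.lt_right.le hzd', e1, e2, hdet.start_eq, hdet.finish_eq,
      hc.left_eq, hd.left_eq, hc.right_eq, hd.right_eq]
    simp only [Complex.add_im]
    ring
  constructor
  · rwa [hJ]
  · rw [hJ, ← hc.range_eq, ← hd.range_eq]
    exact union_subset_union (image_subset_range _ _) (image_subset_range _ _)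
  · rw [hJ]; exact hJP.subset_closure_innerRegion
  · rw [hJ]; exact hJP.subset_closure_outerRegion
  · intro z hz hz'
    rw [hJ] at hz'
    have := hdiff z hz
    rw [hJP.logVar_eq_of_mem_outerRegion hz'] at this
    linarith
  · intro z hz hz' he
    rw [hJ] at hz'
    have := hdiff z hz
    exact hJP.im_ne_of_mem_innerRegion hz' (by linarith)
  · refine hJP.im_le_or_le.imp (fun hle z hz => ?_) fun hle z hz => ?_
    all_goals
      have h1 := hdiff z hz
      have h2 := hle z (disjoint_right.1 hdisj hz)
      linarith

/-- Betweenness of lines in the complex plane. -/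
def LineBetween (γ γ' σ : Set ℂ) : Prop :=
  closure (symmDiff γ σ) ⊆ closure (innerRegion (closure (symmDiff γ γ')))

section

variable {D σ σ' γ : Set ℂ} {f f' g : ℂ → ℝ}

lemma HeightPair.lineBetween (hD : Dense D) (hσγ : HeightPair D σ γ f g)
    (hσσ' : HeightPair D σ σ' f f') (h1 : ∀ z ∈ D, f z ≤ g z) (h2 : ∀ z ∈ D, g z ≤ f' z) :
    LineBetween σ σ' γ := by
  refine hσγ.subset_closure_inner.trans ?_
  refine (closure_mono (hD.open_subset_closure_inter
    (isOpen_innerRegion isClosed_closure))).trans ?_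
  rw [closure_closure]
  refine closure_mono fun z hz => ?_
  refine (mem_innerRegion_or_mem_outerRegion
    (disjoint_right.1 hσσ'.disjoint hz.2)).resolve_right fun ho => ?_
  have e1 := hσγ.ne_of_inner z hz.2 hz.1
  have e2 := hσσ'.eq_of_outer z hz.2 ho
  exact e1 (le_antisymm (h1 z hz.2) (e2 ▸ h2 z hz.2))

lemma HeightPair.exists_lt (hD : Dense D) (hσσ' : HeightPair D σ σ' f f')
    (hγσ' : HeightPair D γ σ' g f') {x : ℂ} (hx : x ∈ γ) (hxσ' : x ∉ σ')
    (hxi : x ∈ innerRegion (closure (symmDiff σ σ'))) (hff' : ∀ z ∈ D, f z ≤ f' z) :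
    ∃ z ∈ D, f z < g z := by
  obtain ⟨y, hy, hy'⟩ := mem_closure_iff.1
    (hγσ'.subset_closure_outer (subset_closure (Or.inl ⟨hx, hxσ'⟩))) _
    (isOpen_innerRegion isClosed_closure) hxi
  obtain ⟨z, ⟨hz, hz'⟩, hzD⟩ := hD.inter_open_nonempty _
    ((isOpen_innerRegion isClosed_closure).inter (isOpen_outerRegion isClosed_closure))
    ⟨y, hy, hy'⟩
  refine ⟨z, hzD, ?_⟩
  rw [hγσ'.eq_of_outer z hzD hz']
  exact lt_of_le_of_ne (hff' z hzD) (hσσ'.ne_of_inner z hzD hz)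

lemma HeightPair.exists_lt_of_lineBetween (hD : Dense D) (hσσ' : HeightPair D σ σ' f f')
    (hγσ : HeightPair D γ σ g f) (hγσ' : HeightPair D γ σ' g f') {x : ℂ} (hx : x ∈ γ)
    (hxσ : x ∉ σ) (hxσ' : x ∉ σ') (hb : LineBetween σ σ' γ) :
    (∃ z ∈ D, f z < g z) ∨ ∃ z ∈ D, f' z < g z := by
  have hxi : x ∈ innerRegion (closure (symmDiff σ σ')) :=
    (closure_innerRegion_subset isClosed_closure
      (hb (subset_closure (Or.inr ⟨hx, hxσ⟩)))).resolve_right fun h =>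
        (hσσ'.subset_union h).elim hxσ hxσ'
  rcases hσσ'.total with h | h
  · exact Or.inl (hσσ'.exists_lt hD hγσ' hx hxσ' hxi h)
  · refine Or.inr (hσσ'.symm.exists_lt hD hγσ hx hxσ ?_ h)
    rwa [symmDiff_comm]

/-- Transitivity of betweenness, when the heights of `σ` are below those of `γ`. -/
lemma HeightPair.lineBetween_trans {σ'' : Set ℂ} {f'' : ℂ → ℝ} (hD : Dense D)
    (hσγ : HeightPair D σ γ f g) (hσσ' : HeightPair D σ σ' f f')
    (hσσ'' : HeightPair D σ σ'' f f'') (hγσ' : HeightPair D γ σ' g f')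
    (hγσ'' : HeightPair D γ σ'' g f'') (hσ'σ'' : HeightPair D σ' σ'' f' f'')
    {x : ℂ} (hx : x ∈ γ) (hxσ : x ∉ σ) (hxσ' : x ∉ σ') (hin : LineBetween σ σ' γ)
    (hout : ¬ LineBetween σ σ'' γ) (hle : ∀ z ∈ D, f z ≤ g z) : LineBetween σ' σ'' γ := by
  have h1 : ∀ z ∈ D, g z ≤ f' z := by
    refine hγσ'.total.resolve_right fun h => ?_
    rcases hσσ'.neg.exists_lt_of_lineBetween hD hσγ.symm.neg hγσ'.neg hx hxσ hxσ' hin with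
      ⟨z, hz, hlt⟩ | ⟨z, hz, hlt⟩
    · exact (neg_lt_neg_iff.1 hlt).not_ge (hle z hz)
    · exact (neg_lt_neg_iff.1 hlt).not_ge (h z hz)
  have h2 : ∀ z ∈ D, f'' z ≤ g z :=
    hγσ''.total.resolve_left fun h => hout (hσγ.lineBetween hD hσσ'' hle h)
  exact hγσ'.symm.neg.lineBetween hD hσ'σ''.neg (fun z hz => neg_le_neg (h1 z hz))
    fun z hz => neg_le_neg (h2 z hz)

end

/-- Two detours from `c`, one after the other, yield lines differing on a disconnected set. -/
lemma Detour.not_le {c d e : ℝ → ℂ} {a b a' b' u v u' v' k l : ℝ}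
    (hc : IsEmbedding c) (hd : IsEmbedding d) (he : IsEmbedding e) (hcd : Detour c d a b a' b')
    (hce : Detour c e u v u' v') (hde : {t | d t ∉ range e} = Ioo k l) : ¬ b ≤ u := by
  intro hbu
  obtain ⟨m, hm, hcm, hm'⟩ := exists_image_Ici_eq hc hd hcd.image_Ici hbu
  obtain ⟨t, hut, htv⟩ := exists_between hce.lt_left
  have htd : c t ∈ d '' Ici m := hm' ▸ ⟨t, hut.le, rfl⟩
  obtain ⟨s, hs, hst⟩ := htd
  have hsk : s ∈ Ioo k l := by
    rw [← hde, mem_ofPred_eq, hst]; exact hce.out_left.ge ⟨hut, htv⟩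
  have hmk : m ∉ Ioo k l := by
    rw [← hde, mem_ofPred_eq, ← hcm, hce.start_eq]; simp
  have hms : m < s := lt_of_le_of_ne hs fun h => hut.ne (hc.injective (by rw [hcm, h, hst]))
  have hmk' : m ≤ k := by
    by_contra! h
    exact hmk ⟨h, hms.trans hsk.2⟩
  have hsub : d '' Ioo a' b' ⊆ e '' Ioo u' v' := by
    rw [← range_diff_range_eq hce.out_right, ← range_diff_range_eq hcd.out_right]
    rintro _ ⟨⟨r, rfl⟩, hr⟩
    refine ⟨?_, hr⟩
    by_contra hre
    have h1 : r ∈ Ioo a' b' := hcd.out_right ▸ hr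
    have h2 : r ∈ Ioo k l := hde ▸ hre
    linarith [h1.2, h2.1]
  have hcl := closure_mono hsub
  rw [closure_image_Ioo hd.continuous hcd.lt_right,
    closure_image_Ioo he.continuous hce.lt_right] at hcl
  have ha : c a ∈ e '' Icc u' v' := hcd.start_eq ▸ hcl ⟨a', left_mem_Icc.2 hcd.lt_right.le, rfl⟩
  have ha' : c a ∈ e '' Iic u' := hce.image_Iic ▸ ⟨a, hcd.lt_left.le.trans hbu, rfl⟩
  obtain ⟨x, hx, hxa⟩ := ha
  obtain ⟨y, hy, hya⟩ := ha'
  have hxy : x = y := he.injective (hxa.trans hya.symm)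
  have hxu : x = u' := le_antisymm (hxy ▸ hy) hx.1
  have hau : a = u := hc.injective (by rw [← hxa, hxu, hce.start_eq])
  linarith [hcd.lt_left]

/-- A line is not covered by two other lines. -/
lemma IsParam.exists_notMem {N P : Set ℂ} {p q : ℂ} {γ σ σ' : Set ℂ} {c d e : ℝ → ℂ}
    {T S T' S' U V : ℝ} (hc : IsParam N P p q γ c T S) (hd : IsParam N P p q σ d T' S')
    (he : IsParam N P p q σ' e U V) (h1 : γ ≠ σ) (h2 : γ ≠ σ')
    (hγσ : DiffersByPortion γ σ) (hσγ : DiffersByPortion σ γ) (hγσ' : DiffersByPortion γ σ')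
    (hσ'γ : DiffersByPortion σ' γ) (hσσ' : DiffersByPortion σ σ')
    (hσ'σ : DiffersByPortion σ' σ) : ∃ x ∈ γ, x ∉ σ ∧ x ∉ σ' := by
  by_contra! hcov
  obtain ⟨a, b, a', b', hcd, -⟩ := hc.exists_detour hd h1 hγσ hσγ
  obtain ⟨u, v, u', v', hce, -⟩ := hc.exists_detour he h2 hγσ' hσ'γ
  obtain ⟨k, l, hde⟩ := hσσ' d hd.isEmbedding hd.range_eq
  obtain ⟨k', l', hed⟩ := hσ'σ e he.isEmbedding he.range_eq
  obtain ⟨rfl, rfl, rfl⟩ := And.intro hc.range_eq (And.intro hd.range_eq he.range_eq)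
  have hcases : b ≤ u ∨ v ≤ a := by
    by_contra! h
    obtain ⟨t, ht, ht'⟩ := exists_between (max_lt (lt_min hcd.lt_left h.2)
      (lt_min h.1 hce.lt_left))
    rw [max_lt_iff] at ht
    rw [lt_min_iff] at ht'
    exact hce.out_left.ge ⟨ht.2, ht'.2⟩ (hcov _ ⟨t, rfl⟩ (hcd.out_left.ge ⟨ht.1, ht'.1⟩))
  rcases hcases with h | h
  · exact hcd.not_le hc.isEmbedding hd.isEmbedding he.isEmbedding hce hde h
  · exact hce.not_le hc.isEmbedding he.isEmbedding hd.isEmbedding hcd hed h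

lemma not_injective_of_continuous {ψ : ℂ → ℝ} (hψ : Continuous ψ) :
    ¬ Function.Injective ψ := by
  intro hinj
  obtain ⟨z, w, hzw⟩ : ∃ z w, ψ z < ψ w :=
    (hinj.ne zero_ne_one).lt_or_gt.elim (fun h => ⟨0, 1, h⟩) fun h => ⟨1, 0, h⟩
  obtain ⟨m, hzm, hmw⟩ := exists_between hzw
  obtain ⟨y, rfl⟩ := mem_range_of_exists_le_of_exists_ge hψ ⟨z, hzm.le⟩ ⟨w, hmw.le⟩
  have hconn := ((isConnected_compl_singleton_of_one_lt_rank
    (Complex.rank_real_complex ▸ Nat.one_lt_ofNat) y).isPreconnected.image ψ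
    hψ.continuousOn).ordConnected
  obtain ⟨u, hu, huy⟩ := hconn.out ⟨z, fun h => hzm.ne (congrArg ψ h), rfl⟩
    ⟨w, fun h => hmw.ne' (congrArg ψ h), rfl⟩ ⟨hzm.le, hmw.le⟩
  exact hu (hinj huy)

/-- An embedded line has empty interior. -/
lemma interior_range_eq_empty {c : ℝ → ℂ} (hc : IsEmbedding c) : interior (range c) = ∅ := by
  by_contra hne
  obtain ⟨x, hx⟩ := nonempty_iff_ne_empty.2 hne
  obtain ⟨r, hr, hball⟩ := Metric.isOpen_iff.1 isOpen_interior x hx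
  let u := OpenPartialHomeomorph.univBall x r
  have hmem : ∀ z, ∃ t, c t = u z := fun z => by
    have hz : u z ∈ Metric.ball x r := by
      rw [← OpenPartialHomeomorph.univBall_target x hr]
      exact u.map_source (by simp [u])
    have : u z ∈ range c := interior_subset (hball hz)
    exact this
  choose φ hφ using hmem
  have hcont : Continuous φ := by
    rw [hc.continuous_iff]
    exact (OpenPartialHomeomorph.continuous_univBall x r).congr fun z => (hφ z).symm
  refine not_injective_of_continuous hcont fun z w h => ?_
  exact u.injOn (by simp [u]) (by simp [u]) (by rw [← hφ z, ← hφ w, h])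

lemma isOpen_compl_image_Icc {c : ℝ → ℂ} (hc : IsEmbedding c) (T S : ℝ) :
    IsOpen (c '' Icc T S)ᶜ :=
  (isCompact_Icc.image hc.continuous).isClosed.isOpen_compl

lemma dense_compl_image_Icc {c : ℝ → ℂ} (hc : IsEmbedding c) (T S : ℝ) :
    Dense (c '' Icc T S)ᶜ :=
  interior_eq_empty_iff_dense_compl.1 (subset_empty_iff.1
    ((interior_mono (image_subset_range c _)).trans (interior_range_eq_empty hc).le))

/-- Transitivity of betweenness for lines in the complex plane. -/
theorem lineBetween_trans {Γ : Set (Set ℂ)}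
    (hline : ∀ γ ∈ Γ, ∃ c : ℝ → ℂ, IsEmbedding c ∧ range c = γ)
    (hport : ∀ γ ∈ Γ, ∀ γ' ∈ Γ, γ ≠ γ' → DiffersByPortion γ γ') {γ σ σ' σ'' : Set ℂ}
    (hγ : γ ∈ Γ) (hσ : σ ∈ Γ) (hσ' : σ' ∈ Γ) (hσ'' : σ'' ∈ Γ)
    (h1 : γ ≠ σ) (h2 : γ ≠ σ') (h3 : γ ≠ σ'') (h4 : σ ≠ σ') (h5 : σ ≠ σ'') (h6 : σ' ≠ σ'')
    (hin : LineBetween σ σ' γ) (hout : ¬ LineBetween σ σ'' γ) : LineBetween σ' σ'' γ := by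
  obtain ⟨c, hc, hcγ⟩ := hline γ hγ
  have hex : ∀ τ ∈ Γ, γ ≠ τ → ∃ a b, ∀ T ≤ a, ∀ S ≥ b, ∃ d T' S',
      IsParam (c '' Iic T) (c '' Ici S) (c T) (c S) τ d T' S' := fun τ hτ hne => by
    obtain ⟨d, hd, hdτ⟩ := hline τ hτ
    exact exists_isParam hc hcγ hd hdτ hne (hport γ hγ τ hτ hne) (hport τ hτ γ hγ hne.symm)
  obtain ⟨a₁, b₁, H₁⟩ := hex σ hσ h1
  obtain ⟨a₂, b₂, H₂⟩ := hex σ' hσ' h2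
  obtain ⟨a₃, b₃, H₃⟩ := hex σ'' hσ'' h3
  let T := min a₁ (min a₂ a₃)
  let S := max b₁ (max b₂ b₃)
  have P₀ : IsParam (c '' Iic T) (c '' Ici S) (c T) (c S) γ c T S := ⟨hc, hcγ, rfl, rfl, rfl, rfl⟩
  obtain ⟨d₁, T₁, S₁, P₁⟩ := H₁ T (by simp [T]) S (by simp [S])
  obtain ⟨d₂, T₂, S₂, P₂⟩ := H₂ T (by simp [T]) S (by simp [S])
  obtain ⟨d₃, T₃, S₃, P₃⟩ := H₃ T (by simp [T]) S (by simp [S])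
  let D := (c '' Icc T S)ᶜ ∩ ((d₁ '' Icc T₁ S₁)ᶜ ∩ ((d₂ '' Icc T₂ S₂)ᶜ ∩ (d₃ '' Icc T₃ S₃)ᶜ))
  have hD : Dense D :=
    (dense_compl_image_Icc hc _ _).inter_of_isOpen_left
      ((dense_compl_image_Icc P₁.isEmbedding _ _).inter_of_isOpen_left
        ((dense_compl_image_Icc P₂.isEmbedding _ _).inter_of_isOpen_left
          (dense_compl_image_Icc P₃.isEmbedding _ _)
          (isOpen_compl_image_Icc P₂.isEmbedding _ _))
        (isOpen_compl_image_Icc P₁.isEmbedding _ _))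
      (isOpen_compl_image_Icc hc _ _)
  have D₀ : Disjoint (c '' Icc T S) D := disjoint_right.2 fun z hz => hz.1
  have D₁ : Disjoint (d₁ '' Icc T₁ S₁) D := disjoint_right.2 fun z hz => hz.2.1
  have D₂ : Disjoint (d₂ '' Icc T₂ S₂) D := disjoint_right.2 fun z hz => hz.2.2.1
  have D₃ : Disjoint (d₃ '' Icc T₃ S₃) D := disjoint_right.2 fun z hz => hz.2.2.2
  have pγσ := hport _ hγ _ hσ h1
  have pσγ := hport _ hσ _ hγ h1.symm
  have pγσ' := hport _ hγ _ hσ' h2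
  have pσ'γ := hport _ hσ' _ hγ h2.symm
  have pσσ' := hport _ hσ _ hσ' h4
  have pσ'σ := hport _ hσ' _ hσ h4.symm
  have Hσγ := P₁.heightPair P₀ h1.symm pσγ pγσ D₁ D₀
  have Hσσ' := P₁.heightPair P₂ h4 pσσ' pσ'σ D₁ D₂
  have Hσσ'' := P₁.heightPair P₃ h5 (hport _ hσ _ hσ'' h5) (hport _ hσ'' _ hσ h5.symm) D₁ D₃
  have Hγσ' := P₀.heightPair P₂ h2 pγσ' pσ'γ D₀ D₂
  have Hγσ'' := P₀.heightPair P₃ h3 (hport _ hγ _ hσ'' h3) (hport _ hσ'' _ hγ h3.symm) D₀ D₃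
  have Hσ'σ'' := P₂.heightPair P₃ h6 (hport _ hσ' _ hσ'' h6) (hport _ hσ'' _ hσ' h6.symm) D₂ D₃
  obtain ⟨x, hx, hxσ, hxσ'⟩ := P₀.exists_notMem P₁ P₂ h1 h2 pγσ pσγ pγσ' pσ'γ pσσ' pσ'σ
  rcases Hσγ.total with h | h
  · exact Hσγ.lineBetween_trans hD Hσσ' Hσσ'' Hγσ' Hγσ'' Hσ'σ'' hx hxσ hxσ' hin hout h
  · exact Hσγ.neg.lineBetween_trans hD Hσσ'.neg Hσσ''.neg Hγσ'.neg Hγσ''.neg Hσ'σ''.neg hx hxσ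
      hxσ' hin hout fun z hz => neg_le_neg (h z hz)

/-- The identification of the real plane with the complex plane. -/
noncomputable def planeHomeo : Plane ≃ₜ ℂ := Complex.equivRealProdCLM.symm.toHomeomorph

lemma isBounded_image_planeHomeo {s : Set Plane} :
    Bornology.IsBounded (planeHomeo '' s) ↔ Bornology.IsBounded s := by
  constructor
  · intro h
    have := Complex.equivRealProdCLM.lipschitz.isBounded_image h
    rwa [image_image, show (fun x => Complex.equivRealProdCLM (planeHomeo x)) = id from
      funext fun x => Complex.equivRealProdCLM.apply_symm_apply x, image_id] at this
  · exact fun h => Complex.equivRealProdCLM.symm.lipschitz.isBounded_image h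

lemma innerRegion_image_planeHomeo (J : Set Plane) :
    innerRegion (planeHomeo '' J) = planeHomeo '' intRegion J := by
  ext z
  obtain ⟨x, rfl⟩ := planeHomeo.surjective z
  rw [planeHomeo.injective.mem_set_image]
  by_cases hx : x ∈ J
  · exact iff_of_false (fun h => h.1 (mem_image_of_mem _ hx)) fun h => h.1 hx
  · have hx' : planeHomeo x ∉ planeHomeo '' J := by rwa [planeHomeo.injective.mem_set_image]
    have hcomp : connectedComponentIn (planeHomeo '' J)ᶜ (planeHomeo x) =
        planeHomeo '' connectedComponentIn Jᶜ x := by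
      rw [planeHomeo.image_connectedComponentIn (show x ∈ Jᶜ from hx),
        image_compl_eq planeHomeo.bijective]
    change (_ ∧ _) ↔ (_ ∧ _)
    rw [hcomp, isBounded_image_planeHomeo]
    simp only [hx, hx', not_false_eq_true]

lemma closure_symmDiff_image_planeHomeo (γ γ' : Set Plane) :
    closure (symmDiff (planeHomeo '' γ) (planeHomeo '' γ')) = planeHomeo '' lineJ γ γ' := by
  rw [lineJ, planeHomeo.image_closure, image_symmDiff planeHomeo.injective]

lemma lineBetween_image_planeHomeo {γ γ' σ : Set Plane} :
    LineBetween (planeHomeo '' γ) (planeHomeo '' γ') (planeHomeo '' σ) ↔ Between γ γ' σ := by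
  rw [LineBetween, Between, closure_symmDiff_image_planeHomeo, closure_symmDiff_image_planeHomeo,
    innerRegion_image_planeHomeo, ← planeHomeo.image_closure,
    image_subset_image_iff planeHomeo.injective]

lemma IsTopLine.exists_isEmbedding {γ : Set Plane} (h : IsTopLine γ) :
    ∃ c : ℝ → ℂ, IsEmbedding c ∧ range c = planeHomeo '' γ := by
  obtain ⟨Φ⟩ := h
  refine ⟨fun t => planeHomeo (Φ t),
    planeHomeo.isEmbedding.comp (IsEmbedding.subtypeVal.comp Φ.isEmbedding), ?_⟩
  ext z; constructor
  · rintro ⟨t, rfl⟩; exact ⟨Φ t, (Φ t).2, rfl⟩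
  · rintro ⟨x, hx, rfl⟩; exact ⟨Φ.symm ⟨x, hx⟩, by simp⟩

lemma IsPortion.differsByPortion {γ γ' : Set Plane} (h : IsPortion γ (γ \ γ')) :
    DiffersByPortion (planeHomeo '' γ) (planeHomeo '' γ') := by
  intro c hc hcγ
  have hrange : range (planeHomeo.symm ∘ c) = γ := by
    rw [range_comp, hcγ, ← image_comp]; simp
  obtain ⟨a, b, hab⟩ := h.2 ((planeHomeo.symm.isEmbedding.comp hc).toHomeomorph.trans
    (Homeomorph.setCongr hrange))
  refine ⟨a, b, hab ▸ ?_⟩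
  ext t
  have hval : (((planeHomeo.symm.isEmbedding.comp hc).toHomeomorph.trans
    (Homeomorph.setCongr hrange) t : γ) : Plane) = planeHomeo.symm (c t) := rfl
  have hmem : planeHomeo.symm (c t) ∈ γ := hrange ▸ mem_range_self (f := planeHomeo.symm ∘ c) t
  simp only [mem_ofPred_eq, hval, mem_sdiff, hmem, true_and]
  rw [← planeHomeo.injective.mem_set_image, planeHomeo.apply_symm_apply]

theorem stmt12 (Γ : Set (Set Plane)) (hline : ∀ γ ∈ Γ, IsTopLine γ)
    (hport : ∀ γ ∈ Γ, ∀ γ' ∈ Γ, γ ≠ γ' → IsPortion γ (γ \ γ'))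
    (γ σ σ' σ'' : Set Plane)
    (hγ : γ ∈ Γ) (hσ : σ ∈ Γ) (hσ' : σ' ∈ Γ) (hσ'' : σ'' ∈ Γ)
    (h1 : γ ≠ σ) (h2 : γ ≠ σ') (h3 : γ ≠ σ'') (h4 : σ ≠ σ') (h5 : σ ≠ σ'')
    (h6 : σ' ≠ σ'')
    (hin : Between σ σ' γ) (hout : ¬ Between σ σ'' γ) :
    Between σ' σ'' γ := by
  have hi := planeHomeo.injective.image_injective
  refine lineBetween_image_planeHomeo.1 (lineBetween_trans (Γ := image planeHomeo '' Γ) ?_ ?_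
    (mem_image_of_mem _ hγ) (mem_image_of_mem _ hσ) (mem_image_of_mem _ hσ')
    (mem_image_of_mem _ hσ'') (hi.ne h1) (hi.ne h2) (hi.ne h3) (hi.ne h4) (hi.ne h5) (hi.ne h6)
    (lineBetween_image_planeHomeo.2 hin) fun h => hout (lineBetween_image_planeHomeo.1 h))
  · rintro _ ⟨τ, hτ, rfl⟩
    exact (hline τ hτ).exists_isEmbedding
  · rintro _ ⟨τ, hτ, rfl⟩ _ ⟨τ', hτ', rfl⟩ hne
    exact (hport τ hτ τ' hτ' fun h => hne (h ▸ rfl)).differsByPortion
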